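/- Let k be a field with char k ≠ 2, let a1, a2, a3 ∈ k^×, and let σ be the k-automorphism of k(x1,x2,x3) of order dividing 2 defined by σ(x1) = a1/x1, σ(x2) = a2/x2, σ(x3) = a3/x3. Then k(x1,x2,x3)^⟨σ⟩ is not k-rational if and only if [k(√a1,√a2,√a3) : k] = 8 (i.e. the splitting field of (X²−a1)(X²−a2)(X²−a3) over k has degree 8). Moreover, if k(x1,x2,x3)^⟨σ⟩ is not k-rational, then it is not retract k-rational. -/

import Mathlib

open MvPolynomial Polynomial

noncomputable section

/-- A field extension `K` of `k` is `k`-rational if it is isomorphic, as a `k`-algebra,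
to a rational function field `k(x₁, …, xₙ)` in finitely many variables. -/
def IsRational (k K : Type*) [Field k] [Field K] [Algebra k K] : Prop :=
  ∃ n : ℕ, Nonempty (K ≃ₐ[k] FractionRing (MvPolynomial (Fin n) k))

/-- A field extension `K` of `k` is retract `k`-rational if there is a `k`-subalgebra `A` of `K`
whose fraction field is `K`, together with a nonzero polynomial `f ∈ k[x₁,…,xₙ]` and `k`-algebra
homomorphisms `φ : A → k[x₁,…,xₙ][1/f]` and `ψ : k[x₁,…,xₙ][1/f] → A` with `ψ ∘ φ = id_A`. -/
def IsRetractRational (k K : Type*) [Field k] [Field K] [Algebra k K] : Prop :=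
  ∃ A : Subalgebra k K, IsFractionRing A K ∧
    ∃ (n : ℕ) (f : MvPolynomial (Fin n) k), f ≠ 0 ∧
      ∃ (φ : A →ₐ[k] Localization.Away f) (ψ : Localization.Away f →ₐ[k] A),
        ψ.comp φ = AlgHom.id k A

section Reciprocity

variable {F M G : Type*} [Field F] [Field M] [Algebra F M] [Group G]
  [MulSemiringAction G M]

theorem smul_map_algebraMap [SMulCommClass G F M] (g : G) (r : F[X]) :
    g • r.map (algebraMap F M) = r.map (algebraMap F M) := by
  ext n
  simp [Polynomial.smul_eq_map, smul_algebraMap]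

theorem exists_map_eq_of_smul_eq [Algebra.IsInvariant F M G] (P : M[X])
    (hP : ∀ g : G, g • P = P) : ∃ p : F[X], p.map (algebraMap F M) = P := by
  rw [← Polynomial.mem_lifts, Polynomial.lifts_iff_coeff_lifts]
  intro n
  refine Algebra.IsInvariant.isInvariant (G := G) _ fun g => ?_
  conv_rhs => rw [← hP g]
  simp [Polynomial.smul_eq_map]

theorem smul_prod_smul [Fintype G] {N : Type*} [CommRing N] [MulSemiringAction G N] (q : N) (h : G) :
    h • ∏ g : G, g • q = ∏ g : G, g • q := by
  rw [Finset.smul_prod']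
  simp_rw [← mul_smul]
  exact Fintype.prod_equiv (Equiv.mulLeft h) _ _ fun g => rfl

/-- Away from characteristic two, if every `t i` is a square modulo an irreducible `p`, then `p`
is up to a constant the norm of a polynomial over the field generated by the square roots. -/
theorem exists_eq_prod_smul_of_irreducible [Fintype G] [SMulCommClass G F M]
    [Algebra.IsInvariant F M G] {ι : Type*} (h2 : (2 : M) ≠ 0) (s : ι → M)
    (hs0 : ∀ i, s i ≠ 0)
    (hG : ∀ g : G, g ≠ 1 → ∃ i, g • s i = -s i)
    (p : F[X]) (hp : Irreducible p)
    (t : ι → F) (ht : ∀ i, algebraMap F M (t i) = s i ^ 2)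
    (hpt : ∀ i, ∃ r : F[X], p ∣ r ^ 2 - Polynomial.C (t i)) :
    ∃ (c : F) (q : M[X]),
      p.map (algebraMap F M) = Polynomial.C (algebraMap F M c) * ∏ g : G, g • q := by
  have hpm : ¬ IsUnit (p.map (algebraMap F M)) := by
    intro h
    have := Polynomial.natDegree_eq_zero_of_isUnit h
    rw [Polynomial.natDegree_map] at this
    exact hp.natDegree_pos.ne' this
  have hpm0 : p.map (algebraMap F M) ≠ 0 := by
    simpa [Polynomial.map_eq_zero] using hp.ne_zero
  obtain ⟨q, hq, hqp⟩ := WfDvdMonoid.exists_irreducible_factor hpm hpm0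
  have hqprime : Prime q := hq.prime
  choose r hr using hpt
  have hsign : ∀ i, ∃ e : M, (e = s i ∨ e = -s i) ∧ q ∣ (r i).map (algebraMap F M) - Polynomial.C e := by
    intro i
    have h1 : q ∣ ((r i).map (algebraMap F M) - Polynomial.C (s i)) *
        ((r i).map (algebraMap F M) - Polynomial.C (-s i)) := by
      have := hqp.trans (Polynomial.map_dvd (algebraMap F M) (hr i))
      convert this using 1
      have h3 : algebraMap F M (t i) = s i ^ 2 := ht i
      simp only [Polynomial.map_sub, Polynomial.map_pow, Polynomial.map_C, h3, map_pow, map_neg]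
      ring
    rcases hqprime.dvd_or_dvd h1 with h | h
    · exact ⟨_, Or.inl rfl, h⟩
    · exact ⟨_, Or.inr rfl, h⟩
  choose e he hqe using hsign
  have hgq (g : G) (i : ι) : g • q ∣ (r i).map (algebraMap F M) - Polynomial.C (g • e i) := by
    have : g • q ∣ g • ((r i).map (algebraMap F M) - Polynomial.C (e i)) := by
      obtain ⟨u, hu⟩ := hqe i
      exact ⟨g • u, by rw [hu, smul_mul']⟩
    rwa [smul_sub, smul_map_algebraMap, Polynomial.smul_C] at this
  have hcop : ∀ g h : G, g ≠ h → IsCoprime (g • q) (h • q) := by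
    intro g h hgh
    obtain ⟨i, hi⟩ := hG (g⁻¹ * h) (by
      intro h'
      exact hgh (inv_mul_eq_one.mp h'))
    have hne : h • e i = -(g • e i) := by
      have h1 : (g⁻¹ * h) • e i = - e i := by
        rcases he i with h' | h' <;> rw [h'] <;> simp [hi]
      rw [← smul_neg, ← h1, ← mul_smul, mul_inv_cancel_left]
    have he0 : g • e i ≠ 0 := by
      rw [smul_ne_zero_iff_ne]
      rcases he i with h' | h' <;> rw [h'] <;> simp [hs0]
    obtain ⟨A, hA⟩ := hgq g i
    obtain ⟨B, hB⟩ := hgq h i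
    rw [hne] at hB
    refine ⟨-A * Polynomial.C (2 * g • e i)⁻¹, B * Polynomial.C (2 * g • e i)⁻¹, ?_⟩
    have h3 : Polynomial.C (2 * g • e i) * Polynomial.C (2 * g • e i)⁻¹ = 1 := by
      rw [← Polynomial.C_mul, mul_inv_cancel₀ (mul_ne_zero h2 he0), Polynomial.C_1]
    rw [← h3]
    simp only [map_neg, map_mul, Polynomial.C_ofNat] at hA hB ⊢
    linear_combination Polynomial.C (2 * g • e i)⁻¹ * (hA - hB)
  have hdvd : ∏ g : G, g • q ∣ p.map (algebraMap F M) := by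
    apply Finset.prod_dvd_of_coprime
    · intro g _ h _ hgh
      exact hcop g h hgh
    · intro g _
      rw [← smul_map_algebraMap g p]
      obtain ⟨u, hu⟩ := hqp
      exact ⟨g • u, by rw [hu, smul_mul']⟩
  obtain ⟨n, hn⟩ := exists_map_eq_of_smul_eq (F := F) (G := G) (∏ g : G, g • q) (smul_prod_smul q)
  rw [← hn, Polynomial.map_dvd_map'] at hdvd
  have hnu : ¬ IsUnit n := by
    intro h
    have h1 : IsUnit (n.map (algebraMap F M)) := h.map (Polynomial.mapRingHom (algebraMap F M))
    rw [hn] at h1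
    have : q ∣ ∏ g : G, g • q := by
      simpa using Finset.dvd_prod_of_mem (fun g : G => g • q) (Finset.mem_univ 1)
    exact hq.not_isUnit (isUnit_of_dvd_unit this h1)
  obtain ⟨u, hu⟩ := hdvd
  have huu : IsUnit u := (hp.isUnit_or_isUnit hu).resolve_left hnu
  obtain ⟨c, hc, rfl⟩ := Polynomial.isUnit_iff.mp huu
  refine ⟨c, q, ?_⟩
  rw [hu, Polynomial.map_mul, hn, Polynomial.map_C, mul_comm]

theorem exists_dvd_sq_sub_of_sq_sub_mul_sq {F : Type*} [Field F] {p P t : F[X]} (hp : Irreducible p)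
    (hpP : ¬ p ∣ P) : ∀ (n : ℕ) (U V W : F[X]), W ≠ 0 → W.natDegree ≤ n →
      U ^ 2 - p * P * V ^ 2 = t * W ^ 2 → ∃ r : F[X], p ∣ r ^ 2 - t := by
  intro n
  induction n with
  | zero =>
    intro U V W hW hn h
    obtain ⟨c, hc, rfl⟩ := Polynomial.isUnit_iff.mp
      (Polynomial.isUnit_iff_degree_eq_zero.mpr
        (by rw [Polynomial.degree_eq_natDegree hW]; simpa using hn))
    have hcc : Polynomial.C c⁻¹ * Polynomial.C c = 1 := by
      rw [← Polynomial.C_mul, inv_mul_cancel₀ hc.ne_zero, Polynomial.C_1]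
    refine ⟨Polynomial.C c⁻¹ * U, P * V ^ 2 * Polynomial.C c⁻¹ ^ 2, ?_⟩
    linear_combination Polynomial.C c⁻¹ ^ 2 * h +
      t * (Polynomial.C c⁻¹ * Polynomial.C c + 1) * hcc
  | succ n ih =>
    intro U V W hW hn h
    by_cases hpW : p ∣ W
    · obtain ⟨W, rfl⟩ := hpW
      have hU : p ∣ U := hp.prime.dvd_of_dvd_pow (n := 2)
        ⟨P * V ^ 2 + t * p * W ^ 2, by linear_combination h⟩
      obtain ⟨U, rfl⟩ := hU
      have hV : p ∣ P * V ^ 2 := by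
        refine ⟨U ^ 2 - t * W ^ 2, mul_left_cancel₀ hp.ne_zero ?_⟩
        linear_combination -h
      obtain ⟨V, rfl⟩ := hp.prime.dvd_of_dvd_pow ((hp.prime.dvd_or_dvd hV).resolve_left hpP)
      have hW' : W ≠ 0 := right_ne_zero_of_mul hW
      refine ih U V W hW' ?_ ?_
      · rw [Polynomial.natDegree_mul hp.ne_zero hW'] at hn
        have := hp.natDegree_pos
        omega
      · apply mul_left_cancel₀ (pow_ne_zero 2 hp.ne_zero)
        linear_combination h
    · obtain ⟨B, A, hAB⟩ := (hp.coprime_iff_not_dvd.mpr hpW)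
      refine ⟨A * U, P * V ^ 2 * A ^ 2 - t * B * (A * W + 1), ?_⟩
      linear_combination A ^ 2 * h + t * (A * W + 1) * hAB

theorem exists_eq_prod_smul_of_forall_sq_sub_mul_sq [Fintype G] [SMulCommClass G F M]
    [Algebra.IsInvariant F M G] {ι : Type*} (h2 : (2 : M) ≠ 0) (s : ι → M)
    (hs0 : ∀ i, s i ≠ 0)
    (hG : ∀ g : G, g ≠ 1 → ∃ i, g • s i = -s i)
    (t : ι → F) (ht : ∀ i, algebraMap F M (t i) = s i ^ 2)
    (P : F[X]) (hP : P ≠ 0)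
    (hPt : ∀ i, ∃ U V W : F[X], W ≠ 0 ∧ U ^ 2 - P * V ^ 2 = Polynomial.C (t i) * W ^ 2) :
    ∃ (c : F) (H : F[X]) (q : M[X]), P.map (algebraMap F M) =
      Polynomial.C (algebraMap F M c) * H.map (algebraMap F M) ^ 2 * ∏ g : G, g • q := by
  suffices ∀ R Q : F[X], P = R * Q → IsRelPrime R Q → ∃ (c : F) (H : F[X]) (q : M[X]),
      R.map (algebraMap F M) =
        Polynomial.C (algebraMap F M c) * H.map (algebraMap F M) ^ 2 * ∏ g : G, g • q from
    this P 1 (mul_one P).symm isRelPrime_one_right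
  intro R
  induction R using UniqueFactorizationMonoid.induction_on_coprime with
  | h0 => intro Q hQ; simp [hP] at hQ
  | h1 hx =>
    intro Q _ _
    obtain ⟨c, hc, rfl⟩ := Polynomial.isUnit_iff.mp hx
    exact ⟨c, 1, 1, by simp⟩
  | hpr n hp =>
    rename_i p
    intro Q hQ hrel
    obtain ⟨m, rfl | rfl⟩ := n.even_or_odd'
    · exact ⟨1, p ^ m, 1, by simp [← pow_mul, mul_comm]⟩
    · have hpQ : ¬ p ∣ Q := fun h =>
        hp.not_isUnit (hrel (dvd_pow_self p (by omega)) h)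
      obtain ⟨c, q, hq⟩ := exists_eq_prod_smul_of_irreducible h2 s hs0 hG p hp.irreducible t ht
        fun i => by
          obtain ⟨U, V, W, hW, h⟩ := hPt i
          refine exists_dvd_sq_sub_of_sq_sub_mul_sq hp.irreducible hpQ _ U (p ^ m * V) W hW
            le_rfl ?_
          rw [← h, hQ]
          ring
      refine ⟨c, p ^ m, q, ?_⟩
      rw [Polynomial.map_pow, Polynomial.map_pow, pow_succ, hq]
      ring
  | hcp hxy ihx ihy =>
    rename_i x y
    intro Q hQ hrel
    obtain ⟨c, H, q, h⟩ := ihx (y * Q) (by rw [hQ]; ring)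
      (IsRelPrime.mul_right hxy (IsRelPrime.of_mul_left_left hrel))
    obtain ⟨c', H', q', h'⟩ := ihy (x * Q) (by rw [hQ]; ring)
      (IsRelPrime.mul_right hxy.symm (IsRelPrime.of_mul_left_right hrel))
    refine ⟨c * c', H * H', q * q', ?_⟩
    simp only [Polynomial.map_mul, h, h', map_mul, smul_mul', Finset.prod_mul_distrib]
    ring

/-- If `P` is represented by the forms `U ^ 2 - t i * W ^ 2` over `F(X)` for all `i`, then the
values of `P` at `0` and `1` differ by a square times a norm. -/
theorem eval_mul_eval_eq_sq_mul_prod_smul [Fintype G] [SMulCommClass G F M]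
    [Algebra.IsInvariant F M G] {ι : Type*} (h2 : (2 : M) ≠ 0) (s : ι → M)
    (hs0 : ∀ i, s i ≠ 0)
    (hG : ∀ g : G, g ≠ 1 → ∃ i, g • s i = -s i)
    (t : ι → F) (ht : ∀ i, algebraMap F M (t i) = s i ^ 2)
    (P : F[X]) (hP : P ≠ 0)
    (hPt : ∀ i, ∃ U V W : F[X], W ≠ 0 ∧ U ^ 2 - P * V ^ 2 = Polynomial.C (t i) * W ^ 2) :
    ∃ h q : M, algebraMap F M (P.eval 0 * P.eval 1) = h ^ 2 * ∏ g : G, g • q := by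
  obtain ⟨c, H, q, h⟩ :=
    exists_eq_prod_smul_of_forall_sq_sub_mul_sq h2 s hs0 hG t ht P hP hPt
  have h0 := congrArg (Polynomial.eval 0) h
  have h1 := congrArg (Polynomial.eval 1) h
  have e0 (g : G) : (g • q).eval 0 = g • q.eval 0 := by
    simpa using Polynomial.smul_eval_smul M g q 0
  have e1 (g : G) : (g • q).eval 1 = g • q.eval 1 := by
    simpa using Polynomial.smul_eval_smul M g q 1
  simp only [Polynomial.eval_mul, Polynomial.eval_pow, Polynomial.eval_C, Polynomial.eval_prod,
    e0, e1, Polynomial.eval_zero_map, Polynomial.eval_one_map] at h0 h1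
  refine ⟨algebraMap F M (c * H.eval 0 * H.eval 1), q.eval 0 * q.eval 1, ?_⟩
  simp only [map_mul, smul_mul', Finset.prod_mul_distrib, h0, h1]
  ring

end Reciprocity

section SemiInvariant

variable {R G : Type*} [CommRing R] [IsDomain R]

theorem multiplicity_mul_of_prime [UniqueFactorizationMonoid R] {p x y : R} (hp : Prime p) (hx : x ≠ 0) (hy : y ≠ 0) :
    multiplicity p (x * y) = multiplicity p x + multiplicity p y :=
  multiplicity_mul hp (FiniteMultiplicity.of_prime_left hp (mul_ne_zero hx hy))

/-- Every prime `p` divides an element `f` which is semi-invariant under the involution `σ`, is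
divisible by `p` exactly once, and divides all semi-invariants which are divisible by `p`. -/
theorem exists_minimal_semiInvariant (σ : R ≃+* R) (hσ : ∀ x, σ (σ x) = x) {p : R}
    (hp : Prime p) :
    ∃ f : R, f ≠ 0 ∧ Associated (σ f) f ∧ p ∣ f ∧ ¬ p ^ 2 ∣ f ∧
      ∀ h : R, Associated (σ h) h → p ∣ h → f ∣ h := by
  by_cases hpp : Associated (σ p) p
  · refine ⟨p, hp.ne_zero, hpp, dvd_rfl, fun h => ?_, fun h _ h' => h'⟩
    obtain ⟨c, hc⟩ := h
    exact hp.not_isUnit (isUnit_iff_exists_inv.mpr ⟨c, mul_left_cancel₀ hp.ne_zero (by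
      linear_combination -hc)⟩)
  · have hσp : Prime (σ p) := (MulEquiv.prime_iff σ).mpr hp
    have hnd : ¬ p ∣ σ p := fun h => hpp (hp.associated_of_dvd hσp h).symm
    refine ⟨p * σ p, mul_ne_zero hp.ne_zero hσp.ne_zero, ?_, dvd_mul_right _ _, ?_, ?_⟩
    · rw [map_mul, hσ, mul_comm]
    · rw [sq]
      intro h
      exact hnd ((mul_dvd_mul_iff_left hp.ne_zero).mp h)
    · rintro h hh ⟨c, rfl⟩
      have h1 : σ p ∣ p * c := (Dvd.intro (σ c) (map_mul σ p c).symm).trans hh.dvd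
      have h2 : ¬ σ p ∣ p := fun h => hpp (hσp.associated_of_dvd hp h)
      exact mul_dvd_mul_left p ((hσp.dvd_or_dvd h1).resolve_left h2)

theorem eq_zero_of_even_sum_multiplicity [UniqueFactorizationMonoid R] [Group G] [Fintype G] [MulSemiringAction G R]
    (hG : ∀ g : G, g * g = 1) (σ : R ≃+* R) (hσ : ∀ x, σ (σ x) = x)
    (hσG : ∀ (g : G) x, σ (g • x) = g • σ x) {S : Type*} [CommRing S] (Φ : R → S)
    (hmul : ∀ x y, x ≠ 0 → y ≠ 0 → Φ (x * y) = Φ x + Φ y)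
    (hunit : ∀ x, IsUnit x → Φ x = 0) (hinv : ∀ (g : G) x, Φ (g • x) = Φ x)
    (htwo : ∀ x, x ≠ 0 → Associated (σ x) x → 2 * Φ x = 0)
    (hone : ∀ x, x ≠ 0 → Associated (σ x) x → ∀ g : G, g ≠ 1 → Associated (g • x) x → Φ x = 0)
    (q : R) (hq0 : q ≠ 0) (hq : Associated (σ q) q)
    (heven : ∀ p : R, Prime p → Even (∑ g : G, multiplicity p (g • q))) : Φ q = 0 := by
  have smul_dvd {x y : R} (g : G) (h : x ∣ y) : g • x ∣ g • y :=
    map_dvd (MulSemiringAction.toRingHom G R g) h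
  have smul_assoc {x y : R} (g : G) (h : Associated x y) : Associated (g • x) (g • y) :=
    h.map (MulSemiringAction.toRingHom G R g)
  have smul_semi {x : R} (g : G) (h : Associated (σ x) x) : Associated (σ (g • x)) (g • x) := by
    rw [hσG]
    exact smul_assoc g h
  have hsum {x y : R} (p : R) (hp : Prime p) (hx : x ≠ 0) (hy : y ≠ 0) :
      ∑ g : G, multiplicity p (g • (x * y)) =
        ∑ g : G, multiplicity p (g • x) + ∑ g : G, multiplicity p (g • y) := by
    rw [← Finset.sum_add_distrib]
    refine Finset.sum_congr rfl fun g _ => ?_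
    rw [smul_mul', multiplicity_mul_of_prime hp]
    · rwa [smul_ne_zero_iff_ne]
    · rwa [smul_ne_zero_iff_ne]
  induction q using (wellFounded_dvdNotUnit (α := R)).induction with
  | _ q ih =>
  have reduce (e q' : R) (hqe : q = e * q') (he : Associated (σ e) e) (heu : ¬ IsUnit e)
      (hee : ∀ p : R, Prime p → Even (∑ g : G, multiplicity p (g • e))) (hΦ : Φ e = 0) :
      Φ q = 0 := by
    have he0 : e ≠ 0 := by rintro rfl; simp [hqe] at hq0
    have hq'0 : q' ≠ 0 := by rintro rfl; simp [hqe] at hq0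
    rw [hqe, hmul _ _ he0 hq'0, hΦ, zero_add]
    refine ih q' ⟨hq'0, e, heu, by rw [hqe, mul_comm]⟩ hq'0 ?_ fun p hp => ?_
    · rw [hqe, map_mul] at hq
      exact hq.of_mul_left he (by simpa using he0)
    · have := heven p hp
      rw [hqe, hsum p hp he0 hq'0] at this
      exact (Nat.even_add.mp this).mp (hee p hp)
  by_cases hqu : IsUnit q
  · exact hunit q hqu
  obtain ⟨p, hpi, hpq⟩ := WfDvdMonoid.exists_irreducible_factor hqu hq0
  have hp : Prime p := hpi.prime
  obtain ⟨f, hf0, hf, hpf, hpf2, hmin⟩ := exists_minimal_semiInvariant σ hσ hp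
  have hfu : ¬ IsUnit f := fun h => hp.not_isUnit (isUnit_of_dvd_unit hpf h)
  obtain ⟨q', hq'⟩ := hmin q hq hpq
  have hq'0 : q' ≠ 0 := by rintro rfl; simp [hq'] at hq0
  have hgg (g : G) (x : R) : g • g • x = x := by rw [← mul_smul, hG, one_smul]
  by_cases hA : ∃ g : G, g ≠ 1 ∧ Associated (g • f) f
  · obtain ⟨g, hg, hgf⟩ := hA
    refine reduce f q' hq' hf hfu (fun P hP => ?_) (hone f hf0 hf g hg hgf)
    rw [← ZMod.natCast_eq_zero_iff_even, Nat.cast_sum]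
    refine Finset.sum_involution (fun h _ => h * g) (fun h _ => ?_) (fun h _ _ => ?_)
      (fun _ _ => Finset.mem_univ _) (fun h _ => ?_)
    · rw [mul_smul, multiplicity_eq_of_associated_right (smul_assoc h hgf)]
      exact CharTwo.add_self_eq_zero _
    · simpa using hg
    · rw [mul_assoc, hG, mul_one]
  · push Not at hA
    have hvf : multiplicity p f = 1 :=
      multiplicity_eq_of_dvd_of_not_dvd (by simpa using hpf) hpf2
    have hvg (g : G) (hg : g ≠ 1) : multiplicity p (g • f) = 0 := by
      refine multiplicity_eq_zero.mpr fun h => hA g hg ?_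
      have h1 : f ∣ g • f := hmin _ (smul_semi g hf) h
      have h2 := smul_dvd g h1
      rw [hgg] at h2
      exact associated_of_dvd_dvd h2 h1
    have h1 := heven p hp
    rw [hq', hsum p hp hf0 hq'0, Finset.sum_eq_single 1 (fun g _ hg => hvg g hg) (by simp),
      one_smul, hvf] at h1
    obtain ⟨g, hg⟩ : ∃ g : G, multiplicity p (g • q') ≠ 0 := by
      by_contra! h
      simp [h] at h1
    rw [multiplicity_ne_zero] at hg
    have hq's : Associated (σ q') q' := by
      rw [hq', map_mul] at hq
      exact hq.of_mul_left hf (by simpa using hf0)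
    have h2 := smul_dvd g (hmin _ (smul_semi g hq's) hg)
    rw [hgg] at h2
    obtain ⟨q'', hq''⟩ := h2
    have hgf0 : g • f ≠ 0 := by rwa [smul_ne_zero_iff_ne]
    refine reduce (f * g • f) q'' (by rw [hq', hq'', mul_assoc]) ?_ ?_ (fun P hP => ?_) ?_
    · rw [map_mul]
      exact hf.mul_mul (smul_semi g hf)
    · exact fun h => hfu (isUnit_of_mul_isUnit_left h)
    · rw [hsum P hP hf0 hgf0]
      refine ⟨∑ h : G, multiplicity P (h • f), ?_⟩
      congr 1
      simp_rw [← mul_smul]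
      exact Fintype.sum_equiv (Equiv.mulRight g) _ _ fun h => rfl
    · rw [hmul _ _ hf0 hgf0, hinv, ← two_mul]
      exact htwo f hf0 hf

end SemiInvariant

/-- Laurent polynomials in three variables. -/
abbrev Laurent (l : Type*) [Field l] := AddMonoidAlgebra l (Fin 3 → ℤ)

/-- The group of sign changes in three coordinates. -/
abbrev Signs := Fin 3 → ℤˣ

namespace Laurent

variable {l : Type*} [Field l]

/-- The ring homomorphism recording the `w`-weight of each monomial. -/
def weightHom (w : Fin 3 → ℤ) : Laurent l →+* HahnSeries ℤ (Laurent l) :=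
  AddMonoidAlgebra.liftNCRingHom (HahnSeries.C.comp AddMonoidAlgebra.singleZeroRingHom)
    { toFun := fun m => HahnSeries.single (w ⬝ᵥ m.toAdd) (AddMonoidAlgebra.single m.toAdd 1)
      map_one' := by simp [← AddMonoidAlgebra.one_def]
      map_mul' := fun m n => by simp [dotProduct_add] }
    fun _ _ => Commute.all _ _

theorem coeff_weightHom (w : Fin 3 → ℤ) (f : Laurent l) (n : ℤ) (m : Fin 3 → ℤ) :
    ((weightHom w f).coeff n).coeff m = if w ⬝ᵥ m = n then f.coeff m else 0 := by
  induction f using AddMonoidAlgebra.induction_linear with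
  | zero => simp
  | add x y hx hy =>
    rw [map_add, HahnSeries.coeff_add, AddMonoidAlgebra.coeff_add, Finsupp.add_apply, hx, hy]
    split_ifs <;> simp
  | single a r =>
    have : weightHom w (AddMonoidAlgebra.single a r : Laurent l) =
        HahnSeries.single (w ⬝ᵥ a) (AddMonoidAlgebra.single a r) := by
      refine (AddMonoidAlgebra.liftNC_single _ _ _ _).trans ?_
      simp [AddMonoidAlgebra.singleZeroRingHom]
    rw [this, HahnSeries.coeff_single, AddMonoidAlgebra.coeff_single, Finsupp.single_apply]
    by_cases ha : a = m
    · subst ha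
      by_cases hn : w ⬝ᵥ a = n
      · simp [hn]
      · simp [hn, Ne.symm hn]
    · by_cases hn : n = w ⬝ᵥ a <;> simp [hn, ha]

theorem weightHom_injective (w : Fin 3 → ℤ) :
    Function.Injective (weightHom w : Laurent l →+* _) := by
  rw [injective_iff_map_eq_zero]
  intro f hf
  ext m
  have := coeff_weightHom w f (w ⬝ᵥ m) m
  simpa [hf] using this.symm

/-- The least `w`-weight of a monomial of `f`. -/
def weight (w : Fin 3 → ℤ) (f : Laurent l) : ℤ := (weightHom w f).order

theorem weight_mul (w : Fin 3 → ℤ) {f g : Laurent l} (hf : f ≠ 0) (hg : g ≠ 0) :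
    weight w (f * g) = weight w f + weight w g := by
  rw [weight, map_mul, HahnSeries.order_mul]
  · rfl
  · rwa [Ne, map_eq_zero_iff _ (weightHom_injective w)]
  · rwa [Ne, map_eq_zero_iff _ (weightHom_injective w)]

theorem weight_le (w : Fin 3 → ℤ) {f : Laurent l} {m : Fin 3 → ℤ} (hm : f.coeff m ≠ 0) :
    weight w f ≤ w ⬝ᵥ m := by
  apply HahnSeries.order_le_of_coeff_ne_zero
  intro h
  have := coeff_weightHom w f (w ⬝ᵥ m) m
  simp [h] at this
  exact hm this.symm

theorem exists_weight_eq (w : Fin 3 → ℤ) {f : Laurent l} (hf : f ≠ 0) :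
    ∃ m, f.coeff m ≠ 0 ∧ weight w f = w ⬝ᵥ m := by
  have h0 : weightHom w f ≠ 0 := by rwa [Ne, map_eq_zero_iff _ (weightHom_injective w)]
  have h1 : (weightHom w f).coeff (weightHom w f).order ≠ 0 := by
    simpa using h0
  obtain ⟨m, hm⟩ : ∃ m, ((weightHom w f).coeff (weightHom w f).order).coeff m ≠ 0 := by
    by_contra! h
    exact h1 (AddMonoidAlgebra.ext (Finsupp.ext h))
  rw [coeff_weightHom] at hm
  split_ifs at hm with h
  · exact ⟨m, hm, h.symm⟩
  · exact absurd rfl hm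

theorem weight_single (w m : Fin 3 → ℤ) {c : l} (hc : c ≠ 0) :
    weight w (AddMonoidAlgebra.single m c) = w ⬝ᵥ m := by
  obtain ⟨m', hm', h⟩ := exists_weight_eq w (AddMonoidAlgebra.single_ne_zero (m := m) |>.mpr hc)
  rw [AddMonoidAlgebra.coeff_single, Finsupp.single_apply] at hm'
  split_ifs at hm' with h'
  · rw [h, h']
  · exact absurd rfl hm'

theorem weight_one (w : Fin 3 → ℤ) : weight w (1 : Laurent l) = 0 := by
  rw [AddMonoidAlgebra.one_def, weight_single w 0 one_ne_zero, dotProduct_zero]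

theorem weight_add_weight_neg_nonpos (w : Fin 3 → ℤ) {f : Laurent l} (hf : f ≠ 0) :
    weight w f + weight (-w) f ≤ 0 := by
  obtain ⟨m, hm, -⟩ := exists_weight_eq w hf
  have h1 := weight_le w hm
  have h2 := weight_le (-w) hm
  rw [neg_dotProduct] at h2
  linarith

theorem exists_eq_single_of_isUnit {u : Laurent l} (hu : IsUnit u) :
    ∃ m c, c ≠ 0 ∧ u = AddMonoidAlgebra.single m c := by
  obtain ⟨v, huv⟩ := hu.exists_right_inv
  have hu0 : u ≠ 0 := left_ne_zero_of_mul_eq_one huv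
  have hv0 : v ≠ 0 := right_ne_zero_of_mul_eq_one huv
  have hw (w : Fin 3 → ℤ) : weight w u + weight (-w) u = 0 := by
    have h1 := weight_add_weight_neg_nonpos w hu0
    have h2 := weight_add_weight_neg_nonpos w hv0
    have h3 := weight_mul w hu0 hv0
    have h4 := weight_mul (-w) hu0 hv0
    rw [huv, weight_one] at h3 h4
    linarith
  obtain ⟨m, hm, -⟩ := exists_weight_eq 0 hu0
  refine ⟨m, u.coeff m, hm, ?_⟩
  ext n
  rw [AddMonoidAlgebra.coeff_single, Finsupp.single_apply]
  split_ifs with h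
  · rw [h]
  · by_contra hn
    apply h
    ext i
    have hle {a b : Fin 3 → ℤ} (ha : u.coeff a ≠ 0) (hb : u.coeff b ≠ 0) : a i ≤ b i := by
      have h1 := weight_le (Pi.single i 1) hb
      have h2 := weight_le (-Pi.single i 1) ha
      have h3 := hw (Pi.single i 1)
      rw [neg_dotProduct, single_one_dotProduct] at h2
      rw [single_one_dotProduct] at h1
      linarith
    exact le_antisymm (hle hm hn) (hle hn hm)

theorem ext_weight {f g : Laurent l} (hf : f ≠ 0) (hg : g ≠ 0)  (w w' : Fin 3 → ℤ)
    (h : ∀ m, f.coeff m ≠ 0 → ∃ n, g.coeff n ≠ 0 ∧ w' ⬝ᵥ n = w ⬝ᵥ m)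
    (h' : ∀ m, g.coeff m ≠ 0 → ∃ n, f.coeff n ≠ 0 ∧ w ⬝ᵥ n = w' ⬝ᵥ m) :
    weight w f = weight w' g := by
  obtain ⟨m, hm, hwm⟩ := exists_weight_eq w hf
  obtain ⟨n, hn, hwn⟩ := exists_weight_eq w' hg
  obtain ⟨m', hm', h1⟩ := h m hm
  obtain ⟨n', hn', h2⟩ := h' n hn
  have h3 := weight_le w' hm'
  have h4 := weight_le w hn'
  omega

/-- The endomorphism of the Laurent polynomial ring negating the variables. -/
def negVarsHom : Laurent l →+* Laurent l :=
  AddMonoidAlgebra.liftNCRingHom AddMonoidAlgebra.singleZeroRingHom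
    { toFun := fun m => AddMonoidAlgebra.single m.toAdd ((-1) ^ (∑ i, m.toAdd i))
      map_one' := by simp [AddMonoidAlgebra.one_def]
      map_mul' := fun m n => by
        simp [Finset.sum_add_distrib, zpow_add₀, AddMonoidAlgebra.single_mul_single] }
    fun _ _ => Commute.all _ _

theorem negVarsHom_single (m : Fin 3 → ℤ) (c : l) :
    negVarsHom (AddMonoidAlgebra.single m c) =
      AddMonoidAlgebra.single m ((-1) ^ (∑ i, m i) * c) := by
  refine (AddMonoidAlgebra.liftNC_single _ _ _ _).trans ?_
  simp [AddMonoidAlgebra.singleZeroRingHom, mul_comm c]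

theorem coeff_negVarsHom (f : Laurent l) (m : Fin 3 → ℤ) :
    (negVarsHom f).coeff m = (-1) ^ (∑ i, m i) * f.coeff m := by
  induction f using AddMonoidAlgebra.induction_linear with
  | zero => simp
  | add x y hx hy => simp [hx, hy, mul_add]
  | single a r =>
    rw [negVarsHom_single, AddMonoidAlgebra.coeff_single, AddMonoidAlgebra.coeff_single,
      Finsupp.single_apply, Finsupp.single_apply]
    split_ifs with h
    · rw [h]
    · simp

theorem neg_one_zpow_mul_self (n : ℤ) : (-1 : l) ^ n * (-1) ^ n = 1 := by
  rw [← mul_zpow]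
  simp

theorem negVarsHom_negVarsHom (f : Laurent l) : negVarsHom (negVarsHom f) = f := by
  ext m
  rw [coeff_negVarsHom, coeff_negVarsHom, ← mul_assoc, neg_one_zpow_mul_self, one_mul]

/-- The involution of the Laurent polynomial ring negating the variables. -/
def negVars : Laurent l ≃+* Laurent l :=
  RingEquiv.ofRingHom negVarsHom negVarsHom (RingHom.ext negVarsHom_negVarsHom)
    (RingHom.ext negVarsHom_negVarsHom)

theorem negVars_negVars (f : Laurent l) : negVars (negVars f) = f := negVarsHom_negVarsHom f

theorem coeff_negVars (f : Laurent l) (m : Fin 3 → ℤ) :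
    (negVars f).coeff m = (-1) ^ (∑ i, m i) * f.coeff m := coeff_negVarsHom f m

theorem negVars_single (m : Fin 3 → ℤ) (c : l) :
    negVars (AddMonoidAlgebra.single m c) =
      AddMonoidAlgebra.single m ((-1) ^ (∑ i, m i) * c) := negVarsHom_single m c

theorem weight_negVars (w : Fin 3 → ℤ) {f : Laurent l} (hf : f ≠ 0) :
    weight w (negVars f) = weight w f := by
  have h (m : Fin 3 → ℤ) : (negVars f).coeff m ≠ 0 ↔ f.coeff m ≠ 0 := by
    simp [coeff_negVars, zpow_ne_zero]
  exact ext_weight ((map_ne_zero_iff negVars negVars.injective).mpr hf) hf w w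
    (fun m hm => ⟨m, (h m).mp hm, rfl⟩) (fun m hm => ⟨m, (h m).mpr hm, rfl⟩)

/-- The ring endomorphism by which a sign vector acts on Laurent polynomials, given an action of
the sign vectors on the coefficients. -/
def signHom (ρ : Signs →* RingAut l) (g : Signs) : Laurent l →+* Laurent l :=
  (AddMonoidAlgebra.mapDomainRingHom l (DistribSMul.toAddMonoidHom (Fin 3 → ℤ) g)).comp
    (AddMonoidAlgebra.mapRingHom (Fin 3 → ℤ) (ρ g : l →+* l))

theorem signHom_single (ρ : Signs →* RingAut l) (g : Signs) (m : Fin 3 → ℤ) (c : l) :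
    signHom ρ g (AddMonoidAlgebra.single m c) = AddMonoidAlgebra.single (g • m) (ρ g c) := by
  simp [signHom]

theorem signs_mul_self (g : Signs) : g * g = 1 := by
  ext i
  simp

theorem signs_smul_smul (g : Signs) (m : Fin 3 → ℤ) : g • g • m = m := by
  rw [← mul_smul, signs_mul_self, one_smul]

theorem coeff_signHom (ρ : Signs →* RingAut l) (g : Signs) (f : Laurent l) (m : Fin 3 → ℤ) :
    (signHom ρ g f).coeff m = ρ g (f.coeff (g • m)) := by
  induction f using AddMonoidAlgebra.induction_linear with
  | zero => simp
  | add x y hx hy => simp [hx, hy]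
  | single a r =>
    rw [signHom_single, AddMonoidAlgebra.coeff_single, AddMonoidAlgebra.coeff_single,
      Finsupp.single_apply, Finsupp.single_apply]
    have : g • a = m ↔ a = g • m :=
      ⟨fun h => by rw [← h, signs_smul_smul], fun h => by rw [h, signs_smul_smul]⟩
    simp only [this]
    split_ifs <;> simp

/-- The action of sign vectors on Laurent polynomials. -/
@[reducible]
def signsAction (ρ : Signs →* RingAut l) : MulSemiringAction Signs (Laurent l) where
  smul g f := signHom ρ g f
  one_smul f := by
    refine AddMonoidAlgebra.ext (Finsupp.ext fun m => ?_)
    refine (coeff_signHom ρ 1 f m).trans ?_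
    simp
  mul_smul g h f := by
    refine AddMonoidAlgebra.ext (Finsupp.ext fun m => ?_)
    refine (coeff_signHom ρ (g * h) f m).trans ?_
    refine Eq.trans ?_ (coeff_signHom ρ g (signHom ρ h f) m).symm
    rw [coeff_signHom, map_mul, mul_comm g h, mul_smul]
    rfl
  smul_zero g := map_zero (signHom ρ g)
  smul_add g := map_add (signHom ρ g)
  smul_one g := map_one (signHom ρ g)
  smul_mul g := map_mul (signHom ρ g)

theorem signHom_signHom (ρ : Signs →* RingAut l) (g : Signs) (f : Laurent l) :
    signHom ρ g (signHom ρ g f) = f := by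
  let _ := signsAction ρ
  change g • g • f = f
  rw [← mul_smul, signs_mul_self, one_smul]

theorem signHom_ne_zero (ρ : Signs →* RingAut l) (g : Signs) {f : Laurent l} (hf : f ≠ 0) :
    signHom ρ g f ≠ 0 := by
  intro h
  apply hf
  rw [← signHom_signHom ρ g f, h, map_zero]

theorem signs_smul_apply (g : Signs) (m : Fin 3 → ℤ) (i : Fin 3) : (g • m) i = g i * m i := by
  simp [Pi.smul_apply', Units.smul_def]

theorem dotProduct_signs_smul (g : Signs) (w m : Fin 3 → ℤ) : w ⬝ᵥ (g • m) = (g • w) ⬝ᵥ m := by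
  simp only [dotProduct, signs_smul_apply]
  exact Finset.sum_congr rfl fun i _ => by ring

theorem neg_one_zpow_sum_signs_smul (g : Signs) (m : Fin 3 → ℤ) :
    (-1 : l) ^ (∑ i, (g • m) i) = (-1) ^ (∑ i, m i) := by
  have h (n : ℤ) (u : ℤˣ) : (-1 : l) ^ ((u : ℤ) * n) = (-1) ^ n := by
    rcases Int.units_eq_one_or u with rfl | rfl
    · simp
    · simp [zpow_neg, ← inv_zpow, inv_neg]
  simp only [signs_smul_apply, Fin.sum_univ_three]
  rw [zpow_add₀ (by simp), zpow_add₀ (by simp), zpow_add₀ (by simp), zpow_add₀ (by simp), h, h, h]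

theorem negVars_signHom (ρ : Signs →* RingAut l) (g : Signs) (f : Laurent l) :
    negVars (signHom ρ g f) = signHom ρ g (negVars f) := by
  ext m
  rw [coeff_negVars, coeff_signHom, coeff_signHom, coeff_negVars, map_mul,
    neg_one_zpow_sum_signs_smul, map_zpow₀, map_neg, map_one]

theorem weight_signHom (ρ : Signs →* RingAut l) (g : Signs) (w : Fin 3 → ℤ) {f : Laurent l}
    (hf : f ≠ 0) : weight w (signHom ρ g f) = weight (g • w) f := by
  refine ext_weight (signHom_ne_zero ρ g hf) hf w (g • w) (fun m hm => ?_) (fun m hm => ?_)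
  · rw [coeff_signHom] at hm
    exact ⟨g • m, fun h => hm (by rw [h, map_zero]), by
      rw [← dotProduct_signs_smul, signs_smul_smul]⟩
  · refine ⟨g • m, ?_, dotProduct_signs_smul g w m⟩
    rw [coeff_signHom, signs_smul_smul]
    exact (map_ne_zero_iff (ρ g) (ρ g).injective).mpr hm

/-- A sign vector, as a weight vector. -/
def signWeight (e : Signs) : Fin 3 → ℤ := fun i => e i

theorem signs_smul_signWeight (g e : Signs) : g • signWeight e = signWeight (g * e) := by
  ext i
  rw [signs_smul_apply]
  simp [signWeight]

/-- The sum of the weights of a Laurent polynomial over all sign vectors. -/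
def totalWeight (f : Laurent l) : ℤ := ∑ e : Signs, weight (signWeight e) f

theorem totalWeight_mul {f g : Laurent l} (hf : f ≠ 0) (hg : g ≠ 0) :
    totalWeight (f * g) = totalWeight f + totalWeight g := by
  simp only [totalWeight, weight_mul _ hf hg, Finset.sum_add_distrib]

theorem totalWeight_signHom (ρ : Signs →* RingAut l) (g : Signs) (f : Laurent l) :
    totalWeight (signHom ρ g f) = totalWeight f := by
  by_cases hf : f = 0
  · rw [hf, map_zero]
  simp only [totalWeight, weight_signHom ρ g _ hf, signs_smul_signWeight]
  exact Fintype.sum_equiv (Equiv.mulLeft g) _ _ fun e => rfl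

theorem weight_prod (w : Fin 3 → ℤ) {ι : Type*} (s : Finset ι) (f : ι → Laurent l)
    (hf : ∀ i, f i ≠ 0) : weight w (∏ i ∈ s, f i) = ∑ i ∈ s, weight w (f i) := by
  classical
  induction s using Finset.induction_on with
  | empty => simp [weight_one]
  | insert a s ha ih =>
    rw [Finset.prod_insert ha, Finset.sum_insert ha, weight_mul w (hf a), ih]
    exact Finset.prod_ne_zero_iff.mpr fun i _ => hf i

theorem weight_prod_signHom (ρ : Signs →* RingAut l) {f : Laurent l} (hf : f ≠ 0) :
    weight (signWeight 1) (∏ g : Signs, signHom ρ g f) = totalWeight f := by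
  rw [weight_prod _ _ _ fun g => signHom_ne_zero ρ g hf]
  simp only [totalWeight, weight_signHom ρ _ _ hf, signs_smul_signWeight, mul_one]

theorem sum_signWeight_dotProduct (m : Fin 3 → ℤ) : ∑ e : Signs, signWeight e ⬝ᵥ m = 0 := by
  simp only [dotProduct]
  rw [Finset.sum_comm]
  simp only [← Finset.sum_mul]
  refine Finset.sum_eq_zero fun i _ => ?_
  have : ∀ i : Fin 3, ∑ e : Signs, signWeight e i = 0 := by decide
  rw [this, zero_mul]

theorem totalWeight_of_isUnit {u : Laurent l} (hu : IsUnit u) : totalWeight u = 0 := by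
  obtain ⟨m, c, hc, rfl⟩ := exists_eq_single_of_isUnit hu
  simp only [totalWeight, weight_single _ m hc, sum_signWeight_dotProduct]

theorem even_signWeight_dotProduct_sub (e : Signs) (m : Fin 3 → ℤ) :
    Even (signWeight e ⬝ᵥ m - ∑ i, m i) := by
  rw [dotProduct, ← Finset.sum_sub_distrib]
  refine Finset.even_sum _ fun i _ => ?_
  rcases Int.units_eq_one_or (e i) with h | h
  · simp [signWeight, h]
  · exact ⟨-m i, by simp [signWeight, h]; ring⟩

theorem neg_one_zpow_eq_one_iff (h2 : (2 : l) ≠ 0) (n : ℤ) : (-1 : l) ^ n = 1 ↔ Even n := by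
  refine ⟨fun h => ?_, Even.neg_one_zpow⟩
  by_contra hn
  rw [Int.not_even_iff_odd] at hn
  rw [hn.neg_one_zpow] at h
  exact h2 (by linear_combination -h)

theorem even_weight_of_negVars_eq (h2 : (2 : l) ≠ 0) {f : Laurent l} (hf : f ≠ 0)
    (h : negVars f = f) (e : Signs) : Even (weight (signWeight e) f) := by
  obtain ⟨m, hm, hw⟩ := exists_weight_eq (signWeight e) hf
  have h1 := coeff_negVars f m
  rw [h] at h1
  have h3 : (-1 : l) ^ (∑ i, m i) = 1 := mul_right_cancel₀ hm (by rw [← h1, one_mul])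
  rw [neg_one_zpow_eq_one_iff h2] at h3
  rw [hw]
  simpa using (even_signWeight_dotProduct_sub e m).add h3

theorem even_weight_sub_weight (h2 : (2 : l) ≠ 0) {f : Laurent l} (hf : f ≠ 0)
    (h : Associated (negVars f) f) (e e' : Signs) :
    Even (weight (signWeight e) f - weight (signWeight e') f) := by
  obtain ⟨u, hu⟩ := h
  obtain ⟨m, c, hc, huc⟩ := exists_eq_single_of_isUnit u.isUnit
  have hσf : negVars f ≠ 0 := (map_ne_zero_iff negVars negVars.injective).mpr hf
  have hm : m = 0 := by
    ext i
    have h1 := weight_mul (Pi.single i 1) hσf u.ne_zero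
    rw [hu, weight_negVars _ hf, huc, weight_single _ m hc, single_one_dotProduct] at h1
    simpa using h1
  subst hm
  have hcoeff (n : Fin 3 → ℤ) (hn : f.coeff n ≠ 0) : (-1 : l) ^ (∑ i, n i) = c := by
    have h1 : f.coeff n = (-1) ^ (∑ i, n i) * f.coeff n * c := by
      conv_lhs => rw [← hu, huc]
      rw [AddMonoidAlgebra.coeff_mul_single_zero, coeff_negVars]
    have h3 : (-1 : l) ^ (∑ i, n i) * c = 1 := mul_right_cancel₀ hn (by linear_combination -h1)
    linear_combination c * neg_one_zpow_mul_self (l := l) (∑ i, n i) - (-1 : l) ^ (∑ i, n i) * h3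
  obtain ⟨n, hn, hw⟩ := exists_weight_eq (signWeight e) hf
  obtain ⟨n', hn', hw'⟩ := exists_weight_eq (signWeight e') hf
  have h3 : (-1 : l) ^ (∑ i, n i - ∑ i, n' i) = 1 := by
    rw [zpow_sub₀ (by simp), hcoeff n hn, hcoeff n' hn', div_self hc]
  rw [neg_one_zpow_eq_one_iff h2] at h3
  rw [hw, hw']
  obtain ⟨r, hr⟩ := even_signWeight_dotProduct_sub e n
  obtain ⟨r', hr'⟩ := even_signWeight_dotProduct_sub e' n'
  obtain ⟨r'', hr''⟩ := h3
  exact ⟨r - r' + r'', by linear_combination hr - hr' + hr''⟩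

theorem even_totalWeight (h2 : (2 : l) ≠ 0) {f : Laurent l} (hf : f ≠ 0)
    (h : Associated (negVars f) f) : Even (totalWeight f) := by
  have h1 : totalWeight f = ∑ e : Signs, (weight (signWeight e) f - weight (signWeight 1) f) +
      8 * weight (signWeight 1) f := by
    rw [Finset.sum_sub_distrib, totalWeight]
    simp
  rw [h1]
  exact (Finset.even_sum _ fun e _ => even_weight_sub_weight h2 hf h e 1).add
    (Even.mul_right (by decide) _)

theorem sum_add_sum_smul {S : Type*} [AddCommMonoid S] (g : Signs) (i : Fin 3) (hg : g i = -1)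
    (φ : Signs → S) :
    ∑ e : Signs, φ e = ∑ e : Signs with e i = 1, (φ e + φ (g * e)) := by
  rw [← Finset.sum_filter_add_sum_filter_not Finset.univ (fun e : Signs => e i = 1),
    Finset.sum_add_distrib]
  congr 1
  refine Finset.sum_bij' (fun e _ => g * e) (fun e _ => g * e) ?_ ?_ ?_ ?_ ?_
  · intro e he
    have := (Int.units_eq_one_or (e i)).resolve_left (by simpa using he)
    simp [hg, this]
  · intro e he
    have : e i = 1 := by simpa using he
    simp [hg, this]
  · intro e _
    rw [← mul_assoc, signs_mul_self, one_mul]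
  · intro e _
    rw [← mul_assoc, signs_mul_self, one_mul]
  · intro e _
    rw [← mul_assoc, signs_mul_self, one_mul]

theorem four_dvd_totalWeight (h2 : (2 : l) ≠ 0) (ρ : Signs →* RingAut l) {f : Laurent l}
    (hf : f ≠ 0) (h : Associated (negVars f) f) {g : Signs} (hg : g ≠ 1)
    (hgf : Associated (signHom ρ g f) f) : (4 : ℤ) ∣ totalWeight f := by
  obtain ⟨i, hi⟩ := Function.ne_iff.mp hg
  have hgi : g i = -1 := (Int.units_eq_one_or (g i)).resolve_left hi
  obtain ⟨u, hu⟩ := hgf.symm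
  obtain ⟨m, c, hc, huc⟩ := exists_eq_single_of_isUnit u.isUnit
  have hw (e : Signs) : weight (signWeight (g * e)) f =
      weight (signWeight e) f + signWeight e ⬝ᵥ m := by
    rw [← signs_smul_signWeight, ← weight_signHom ρ g _ hf, ← hu, weight_mul _ hf u.ne_zero, huc,
      weight_single _ m hc]
  rw [totalWeight, sum_add_sum_smul g i hgi]
  have h3 : ∑ e : Signs with e i = 1, signWeight e ⬝ᵥ m = 4 * m i := by
    simp only [dotProduct]
    rw [Finset.sum_comm]
    simp only [← Finset.sum_mul]
    have : ∀ i j : Fin 3, ∑ e : Signs with e i = 1, signWeight e j = if j = i then 4 else 0 := by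
      decide
    simp [this]
  have h4 : ∑ e : Signs with e i = 1,
      (weight (signWeight e) f + weight (signWeight (g * e)) f) =
      2 * ∑ e : Signs with e i = 1, (weight (signWeight e) f - weight (signWeight 1) f) +
      8 * weight (signWeight 1) f + 4 * m i := by
    rw [← h3, Finset.sum_sub_distrib, Finset.sum_const]
    have : ∀ i : Fin 3, (Finset.univ.filter fun e : Signs => e i = 1).card = 4 := by decide
    simp only [hw, this, Finset.sum_add_distrib]
    simp
    ring
  rw [h4]
  obtain ⟨r, hr⟩ := Finset.even_sum
    (fun e => weight (signWeight e) f - weight (signWeight 1) f)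
    (s := Finset.univ.filter fun e : Signs => e i = 1)
    fun e _ => even_weight_sub_weight h2 hf h e 1
  rw [hr]
  exact ⟨r + 2 * weight (signWeight 1) f + m i, by ring⟩

/-- Polynomials embed into Laurent polynomials. -/
def ofPolynomial : MvPolynomial (Fin 3) l →+* Laurent l :=
  AddMonoidAlgebra.mapDomainRingHom l
    ((Nat.castAddMonoidHom ℤ).compLeft (Fin 3) |>.comp Finsupp.coeFnAddHom)

theorem ofPolynomial_monomial (m : Fin 3 →₀ ℕ) (c : l) :
    ofPolynomial (MvPolynomial.monomial m c) = AddMonoidAlgebra.single (fun i => (m i : ℤ)) c :=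
  AddMonoidAlgebra.mapDomain_single

theorem ofPolynomial_injective : Function.Injective (ofPolynomial (l := l)) := by
  refine AddMonoidAlgebra.mapDomain_injective fun m n h => ?_
  ext i
  have := congrFun h i
  simpa using this

theorem isLocalization_ofPolynomial :
    letI := (ofPolynomial (l := l)).toAlgebra
    IsLocalization.Away (MvPolynomial.monomial (Finsupp.equivFunOnFinite.symm 1) 1 :
      MvPolynomial (Fin 3) l) (Laurent l) := by
  let _ := (ofPolynomial (l := l)).toAlgebra
  have hx (n : ℕ) : ofPolynomial ((MvPolynomial.monomial (Finsupp.equivFunOnFinite.symm 1) 1 :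
      MvPolynomial (Fin 3) l) ^ n) = AddMonoidAlgebra.single (fun _ => (n : ℤ)) 1 := by
    rw [MvPolynomial.monomial_pow, ofPolynomial_monomial]
    simp
  refine ⟨?_, ?_, ?_⟩
  · rintro ⟨_, n, rfl⟩
    refine IsUnit.of_mul_eq_one (AddMonoidAlgebra.single (fun _ => -(n : ℤ)) 1) ?_
    refine (congrArg (· * _) (hx n)).trans ?_
    rw [AddMonoidAlgebra.single_mul_single, AddMonoidAlgebra.one_def]
    congr 1
    · ext i
      simp
    · simp
  · intro f
    suffices ∃ (n : ℕ) (p : MvPolynomial (Fin 3) l),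
        f * AddMonoidAlgebra.single (fun _ => (n : ℤ)) 1 = ofPolynomial p by
      obtain ⟨n, p, h⟩ := this
      exact ⟨⟨p, ⟨_, n, rfl⟩⟩, (congrArg (f * ·) (hx n)).trans h⟩
    have hadd (a b : ℕ) : (AddMonoidAlgebra.single (fun _ => ((a + b : ℕ) : ℤ)) 1 : Laurent l) =
        AddMonoidAlgebra.single (fun _ => (a : ℤ)) 1 *
          AddMonoidAlgebra.single (fun _ => (b : ℤ)) 1 := by
      rw [AddMonoidAlgebra.single_mul_single]
      congr 1
      simp
    induction f using AddMonoidAlgebra.induction_linear with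
    | zero => exact ⟨0, 0, by simp⟩
    | add f g hf hg =>
      obtain ⟨a, p, hp⟩ := hf
      obtain ⟨b, q, hq⟩ := hg
      refine ⟨a + b, p * (MvPolynomial.monomial (Finsupp.equivFunOnFinite.symm 1) 1) ^ b +
        q * (MvPolynomial.monomial (Finsupp.equivFunOnFinite.symm 1) 1) ^ a, ?_⟩
      rw [map_add, map_mul, map_mul, hx, hx, ← hp, ← hq, hadd]
      ring
    | single m c =>
      refine ⟨∑ i, (m i).natAbs, MvPolynomial.monomial
        (Finsupp.equivFunOnFinite.symm fun i => (m i + ∑ i, (m i).natAbs).toNat) c, ?_⟩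
      rw [ofPolynomial_monomial, AddMonoidAlgebra.single_mul_single, mul_one]
      congr 1
      ext i
      have h1 : (m i).natAbs ≤ ∑ i, (m i).natAbs :=
        Finset.single_le_sum (f := fun i => (m i).natAbs) (fun _ _ => Nat.zero_le _)
          (Finset.mem_univ i)
      have h2 : 0 ≤ m i + ((∑ i, (m i).natAbs : ℕ) : ℤ) := by omega
      simp only [Pi.add_apply, Finsupp.equivFunOnFinite_symm_apply_apply]
      rw [Int.toNat_of_nonneg h2]
  · intro x y h
    exact ⟨1, by rw [ofPolynomial_injective h]⟩

instance : UniqueFactorizationMonoid (Laurent l) := by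
  let _ := (ofPolynomial (l := l)).toAlgebra
  have := isLocalization_ofPolynomial (l := l)
  exact UniqueFactorizationMonoid.of_isLocalization (Submonoid.powers
    (MvPolynomial.monomial (Finsupp.equivFunOnFinite.symm 1) 1 : MvPolynomial (Fin 3) l)) _

theorem sq_ne_sq_mul_prod_signHom (h2 : (2 : l) ≠ 0) (ρ : Signs →* RingAut l)
    {A D Q : Laurent l} (hA0 : A ≠ 0) (hD0 : D ≠ 0) (hQ0 : Q ≠ 0) (hA : negVars A = A)
    (hD : negVars D = D) (hQ : negVars Q = Q) (i : Fin 3) :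
    (AddMonoidAlgebra.single (Pi.single i 1) 1 * A) ^ 2 ≠ D ^ 2 * ∏ g, signHom ρ g Q := by
  intro h
  set y : Laurent l := AddMonoidAlgebra.single (Pi.single i 1) 1 with hy
  have hy0 : y ≠ 0 := AddMonoidAlgebra.single_ne_zero.mpr one_ne_zero
  have hN0 : ∏ g, signHom ρ g Q ≠ 0 :=
    Finset.prod_ne_zero_iff.mpr fun g _ => signHom_ne_zero ρ g hQ0
  have hyw : weight (signWeight 1) y = 1 := by
    rw [hy, weight_single _ _ one_ne_zero, dotProduct_single_one]
    simp [signWeight]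
  have hodd : ¬ (4 : ℤ) ∣ totalWeight Q := by
    have h1 := congrArg (weight (signWeight 1)) h
    rw [sq, sq, weight_mul _ (mul_ne_zero hy0 hA0) (mul_ne_zero hy0 hA0),
      weight_mul _ hy0 hA0, weight_mul _ (mul_ne_zero hD0 hD0) hN0, weight_mul _ hD0 hD0,
      weight_prod_signHom ρ hQ0, hyw] at h1
    obtain ⟨r, hr⟩ := even_weight_of_negVars_eq h2 hA0 hA 1
    obtain ⟨r', hr'⟩ := even_weight_of_negVars_eq h2 hD0 hD 1
    rintro ⟨t, ht⟩
    omega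
  let _ := signsAction ρ
  apply hodd
  have key := eq_zero_of_even_sum_multiplicity (R := Laurent l) signs_mul_self negVars
    negVars_negVars (negVars_signHom ρ) (fun x => (totalWeight x : ZMod 4))
    (fun x y hx hy => by simp only [totalWeight_mul hx hy, Int.cast_add])
    (fun x hx => by simp only [totalWeight_of_isUnit hx, Int.cast_zero])
    (fun g x => congrArg _ (totalWeight_signHom ρ g x))
    (fun x hx hσ => by
      obtain ⟨r, hr⟩ := even_totalWeight h2 hx hσ
      have h4 : (4 : ZMod 4) = 0 := rfl
      simp only [hr, Int.cast_add]
      linear_combination (r : ZMod 4) * h4)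
    (fun x hx hσ g hg hgx =>
      (ZMod.intCast_zmod_eq_zero_iff_dvd _ 4).mpr (four_dvd_totalWeight h2 ρ hx hσ hg hgx))
    Q hQ0 (by rw [hQ]) (fun p hp => ?_)
  · exact (ZMod.intCast_zmod_eq_zero_iff_dvd _ 4).mp key
  · have h1 := congrArg (multiplicity p) h
    have hprod (s : Finset Signs) : multiplicity p (∏ g ∈ s, signHom ρ g Q) =
        ∑ g ∈ s, multiplicity p (signHom ρ g Q) := by
      induction s using Finset.induction_on with
      | empty => simpa [multiplicity_eq_zero] using fun h => hp.not_isUnit (isUnit_of_dvd_one h)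
      | insert a s ha ih =>
        rw [Finset.prod_insert ha, Finset.sum_insert ha,
          multiplicity_mul_of_prime hp (signHom_ne_zero ρ a hQ0), ih]
        exact Finset.prod_ne_zero_iff.mpr fun g _ => signHom_ne_zero ρ g hQ0
    have hyA := mul_ne_zero hy0 hA0
    rw [sq, sq, multiplicity_mul_of_prime hp hyA hyA,
      multiplicity_mul_of_prime hp (mul_ne_zero hD0 hD0) hN0,
      multiplicity_mul_of_prime hp hD0 hD0, hprod] at h1
    change Even (∑ g, multiplicity p (signHom ρ g Q))
    rw [Nat.even_iff]
    omega

end Laurent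

section Transcendence

theorem AlgebraicIndependent.of_adjoin_eq_top {ι k K : Type*} [Finite ι] [Field k] [Field K]
    [Algebra k K] {y z : ι → K} (hy : AlgebraicIndependent k y)
    (h : IntermediateField.adjoin k (Set.range z) = ⊤) : AlgebraicIndependent k z := by
  have hfrac : IsFractionRing (Algebra.adjoin k (Set.range z)) K :=
    .of_field _ _ fun x ↦
      have ⟨r, hr, s, hs, e⟩ := IntermediateField.mem_adjoin_iff_div.mp
        (h ▸ IntermediateField.mem_top : x ∈ IntermediateField.adjoin k (Set.range z))
      ⟨⟨r, hr⟩, ⟨s, hs⟩, e⟩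
  have : Algebra.IsAlgebraic (Algebra.adjoin k (Set.range z)) K :=
    IsLocalization.isAlgebraic _ (nonZeroDivisors (Algebra.adjoin k (Set.range z)))
  exact (Algebra.IsAlgebraic.isTranscendenceBasis_of_lift_le_trdeg_of_finite k z
    hy.lift_cardinalMk_le_trdeg).1

/-- If an algebraically independent finite family lies in the field generated by a family of the
same size, then the latter is algebraically independent as well. -/
theorem AlgebraicIndependent.of_mem_adjoin {ι k K : Type*} [Finite ι] [Field k] [Field K]
    [Algebra k K] {y z : ι → K} (hy : AlgebraicIndependent k y)
    (h : ∀ i, y i ∈ IntermediateField.adjoin k (Set.range z)) : AlgebraicIndependent k z := by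
  obtain ⟨L, hL⟩ : ∃ L, L = IntermediateField.adjoin k (Set.range z) := ⟨_, rfl⟩
  simp_rw [← hL] at h
  have hz (i) : z i ∈ L := hL ▸ IntermediateField.subset_adjoin k _ ⟨i, rfl⟩
  obtain ⟨y', rfl⟩ : ∃ y' : ι → L, y = L.val ∘ y' := ⟨fun i ↦ ⟨y i, h i⟩, rfl⟩
  obtain ⟨z', rfl⟩ : ∃ z' : ι → L, z = L.val ∘ z' := ⟨fun i ↦ ⟨z i, hz i⟩, rfl⟩
  have hy' : AlgebraicIndependent k y' := hy.of_comp L.val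
  have hz' : IntermediateField.adjoin k (Set.range z') = ⊤ := by
    apply IntermediateField.lift_injective L
    rw [IntermediateField.lift_adjoin, IntermediateField.lift_top, ← Set.range_comp]
    exact hL.symm
  exact (hy'.of_adjoin_eq_top hz').map' L.val.injective

end Transcendence

namespace Laurent

section FractionField

variable {l Ω : Type*} [Field l] [Field Ω] [Algebra (Laurent l) Ω]
  [IsFractionRing (Laurent l) Ω] {τ : Ω →+* Ω}
  {ρ : Signs →* RingAut l}

theorem exists_eq_div_of_map_eq (hτ : ∀ f : Laurent l, τ (algebraMap _ Ω f) = algebraMap _ Ω (negVars f))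
    {q : Ω} (hq0 : q ≠ 0) (hq : τ q = q) : ∃ A B : Laurent l, A ≠ 0 ∧ B ≠ 0 ∧
      negVars A = A ∧ negVars B = B ∧ q = algebraMap _ Ω A / algebraMap _ Ω B := by
  obtain ⟨a, b, hb, rfl⟩ := IsFractionRing.div_surjective (Laurent l) q
  have hb0 : b ≠ 0 := nonZeroDivisors.ne_zero hb
  have ha0 : a ≠ 0 := by rintro rfl; simp at hq0
  have hinj := IsFractionRing.injective (Laurent l) Ω
  have hn : negVars b ≠ 0 := (map_ne_zero_iff negVars negVars.injective).mpr hb0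
  have hB : algebraMap _ Ω b ≠ 0 := (map_ne_zero_iff _ hinj).mpr hb0
  have hB' : algebraMap _ Ω (negVars b) ≠ 0 := (map_ne_zero_iff _ hinj).mpr hn
  refine ⟨a * negVars b, b * negVars b, mul_ne_zero ha0 hn, mul_ne_zero hb0 hn, ?_, ?_, ?_⟩
  · apply hinj
    rw [map_div₀, hτ, hτ, div_eq_div_iff hB' hB] at hq
    rw [map_mul, negVars_negVars, map_mul, map_mul, hq]
  · rw [map_mul, negVars_negVars, mul_comm]
  · rw [map_mul, map_mul, mul_div_mul_right _ _ hB']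

variable [MulSemiringAction Signs Ω]

theorem sq_ne_sq_mul_prod_smul (h2 : (2 : l) ≠ 0)
    (hτ : ∀ f : Laurent l, τ (algebraMap _ Ω f) = algebraMap _ Ω (negVars f))
    (hρ : ∀ (g : Signs) (f : Laurent l), g • algebraMap _ Ω f = algebraMap _ Ω (signHom ρ g f))
    {c h q : Ω} (hc0 : c ≠ 0) (hh0 : h ≠ 0) (hq0 : q ≠ 0) (hc : τ c = c) (hh : τ h = h)
    (hq : τ q = q) (i : Fin 3) :
    (algebraMap _ Ω (AddMonoidAlgebra.single (Pi.single i 1) 1 : Laurent l) * c) ^ 2 ≠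
      h ^ 2 * ∏ g : Signs, g • q := by
  intro he
  have hinj := IsFractionRing.injective (Laurent l) Ω
  obtain ⟨C₁, C₂, hC₁, hC₂, hnC₁, hnC₂, rfl⟩ := exists_eq_div_of_map_eq hτ hc0 hc
  obtain ⟨H₁, H₂, hH₁, hH₂, hnH₁, hnH₂, rfl⟩ := exists_eq_div_of_map_eq hτ hh0 hh
  obtain ⟨A, B, hA, hB, hnA, hnB, rfl⟩ := exists_eq_div_of_map_eq hτ hq0 hq
  have hN0 : ∏ g, signHom ρ g B ≠ 0 := Finset.prod_ne_zero_iff.mpr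
    fun g _ ↦ signHom_ne_zero ρ g hB
  have hN : negVars (∏ g, signHom ρ g B) = ∏ g, signHom ρ g B := by
    rw [map_prod]
    exact Finset.prod_congr rfl fun g _ ↦ by rw [negVars_signHom, hnB]
  apply sq_ne_sq_mul_prod_signHom h2 ρ (A := C₁ * H₂ * ∏ g, signHom ρ g B) (D := H₁ * C₂)
    (Q := A * B) (mul_ne_zero (mul_ne_zero hC₁ hH₂) hN0) (mul_ne_zero hH₁ hC₂) (mul_ne_zero hA hB)
    (by rw [map_mul, map_mul, hN, hnC₁, hnH₂]) (by rw [map_mul, hnH₁, hnC₂])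
    (by rw [map_mul, hnA, hnB]) i
  apply hinj
  simp only [smul_div₀', hρ, Finset.prod_div_distrib] at he
  have e1 := (map_ne_zero_iff _ hinj).mpr hC₂
  have e2 := (map_ne_zero_iff _ hinj).mpr hH₂
  have e3 := (map_ne_zero_iff _ hinj).mpr hN0
  rw [map_prod] at e3
  simp only [map_mul, map_pow, map_prod, Finset.prod_mul_distrib]
  field_simp at he
  linear_combination (∏ g, algebraMap _ Ω (signHom ρ g B)) * he

theorem map_smul_of_map_algebraMap
    (hτ : ∀ f : Laurent l, τ (algebraMap _ Ω f) = algebraMap _ Ω (negVars f))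
    (hρ : ∀ (g : Signs) (f : Laurent l), g • algebraMap _ Ω f = algebraMap _ Ω (signHom ρ g f))
    (g : Signs) (x : Ω) : τ (g • x) = g • τ x := by
  obtain ⟨a, b, hb, rfl⟩ := IsFractionRing.div_surjective (Laurent l) x
  simp only [smul_div₀', map_div₀, hτ, hρ, negVars_signHom]

theorem eval_mul_eval_ne (h2 : (2 : l) ≠ 0)
    (hτ : ∀ f : Laurent l, τ (algebraMap _ Ω f) = algebraMap _ Ω (negVars f))
    (hρ : ∀ (g : Signs) (f : Laurent l), g • algebraMap _ Ω f = algebraMap _ Ω (signHom ρ g f))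
    {F : Subfield Ω} (hF : ∀ x, x ∈ F ↔ τ x = x ∧ ∀ g : Signs, g • x = x) {s : Fin 3 → Ω}
    (hs0 : ∀ i, s i ≠ 0) (hτs : ∀ i, τ (s i) = s i)
    (hs : ∀ (g : Signs) i, g • s i = ((g i : ℤ) : Ω) * s i) {t : Fin 3 → F}
    (ht : ∀ i, (t i : Ω) = s i ^ 2) {P : F[X]} (hP : P ≠ 0)
    (hPt : ∀ i, ∃ U V W : F[X], W ≠ 0 ∧ U ^ 2 - P * V ^ 2 = Polynomial.C (t i) * W ^ 2)
    {m : Ω} (hm0 : m ≠ 0) (hm : τ m = m) (i : Fin 3) :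
    ((P.eval 0 * P.eval 1 : F) : Ω) ≠
      (algebraMap _ Ω (AddMonoidAlgebra.single (Pi.single i 1) 1 : Laurent l) * m) ^ 2 := by
  intro he
  have hinj := IsFractionRing.injective (Laurent l) Ω
  let M : Subfield Ω := τ.eqLocusField (RingHom.id Ω)
  have hM (x : Ω) : x ∈ M ↔ τ x = x := Iff.rfl
  have : IsInvariantSubfield Signs M := ⟨fun g x hx ↦ by
    rw [hM] at hx ⊢
    rw [map_smul_of_map_algebraMap hτ hρ, hx]⟩
  have hsmul (g : Signs) (x : M) : ((g • x : M) : Ω) = g • (x : Ω) := rfl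
  let _ : Algebra F M := (Subfield.inclusion fun x hx ↦ ((hF x).mp hx).1 : F →+* M).toAlgebra
  have hmap (x : F) : ((algebraMap F M x : M) : Ω) = x := rfl
  have : SMulCommClass Signs F M := ⟨fun g x y ↦ by
    apply Subtype.ext
    rw [Algebra.smul_def, Algebra.smul_def, hsmul]
    push_cast
    rw [hmap, hsmul, smul_mul', ((hF x).mp x.2).2]⟩
  have : Algebra.IsInvariant F M Signs := ⟨fun b hb ↦
    ⟨⟨b, (hF b).mpr ⟨b.2, fun g ↦ congrArg Subtype.val (hb g)⟩⟩, rfl⟩⟩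
  have h2Ω : (2 : Ω) ≠ 0 := by
    have := (map_ne_zero ((algebraMap (Laurent l) Ω).comp (algebraMap l (Laurent l)))).mpr h2
    rwa [map_ofNat] at this
  obtain ⟨h, q, hq⟩ := eval_mul_eval_eq_sq_mul_prod_smul (F := F) (M := M) (G := Signs)
    (fun h ↦ h2Ω (congrArg Subtype.val h))
    (fun i ↦ (⟨s i, hτs i⟩ : M)) (fun i h ↦ hs0 i (congrArg Subtype.val h))
    (fun g hg ↦ by
      obtain ⟨i, hi⟩ := Function.ne_iff.mp hg
      refine ⟨i, Subtype.ext ((hs g i).trans ?_)⟩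
      simp [(Int.units_eq_one_or (g i)).resolve_left hi]) t (fun i ↦ Subtype.ext (ht i)) P hP hPt
  have hq' : ((P.eval 0 * P.eval 1 : F) : Ω) = (h : Ω) ^ 2 * ∏ g : Signs, g • (q : Ω) := by
    have := congrArg Subtype.val hq
    rw [hmap] at this
    rw [this]
    push_cast
    rfl
  have hy : algebraMap _ Ω (AddMonoidAlgebra.single (Pi.single i 1) 1 : Laurent l) ≠ 0 := by
    rw [map_ne_zero_iff _ hinj]
    exact AddMonoidAlgebra.single_ne_zero.mpr one_ne_zero
  have hne : (h : Ω) ^ 2 * ∏ g : Signs, g • (q : Ω) ≠ 0 := by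
    rw [← hq', he]
    exact pow_ne_zero 2 (mul_ne_zero hy hm0)
  have hh0 : (h : Ω) ≠ 0 := fun h0 ↦ hne (by rw [h0]; simp)
  have hq0 : (q : Ω) ≠ 0 := fun h0 ↦ hne (by rw [h0]; simp)
  exact sq_ne_sq_mul_prod_smul h2 hτ hρ hm0 hh0 hq0 hm h.2 q.2 i (he.symm.trans hq')

end FractionField

end Laurent

namespace Laurent

section Embedding

variable {l Ω : Type*} [Field l] [Field Ω] [Algebra (Laurent l) Ω] {τ : Ω →+* Ω}
  {ρ : Signs →* RingAut l}

/-- The `i`-th variable, as an element of an extension of the ring of Laurent polynomials. -/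
def var (l Ω : Type*) [Field l] [Field Ω] [Algebra (Laurent l) Ω] (i : Fin 3) : Ω :=
  algebraMap _ Ω (AddMonoidAlgebra.single (Pi.single i 1) 1 : Laurent l)

theorem map_var (hτ : ∀ f : Laurent l, τ (algebraMap _ Ω f) = algebraMap _ Ω (negVars f))
    (i : Fin 3) : τ (var l Ω i) = -var l Ω i := by
  rw [var, hτ, negVars_single, ← map_neg, ← AddMonoidAlgebra.single_neg]
  simp

theorem smul_var_of_eq_one [MulSemiringAction Signs Ω]
    (hρ : ∀ (g : Signs) (f : Laurent l), g • algebraMap _ Ω f = algebraMap _ Ω (signHom ρ g f))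
    {g : Signs} {i : Fin 3} (h : g i = 1) : g • var l Ω i = var l Ω i := by
  rw [var, hρ, signHom_single, map_one]
  have : g • (Pi.single i 1 : Fin 3 → ℤ) = Pi.single i 1 := by
    ext j
    rw [signs_smul_apply]
    rcases eq_or_ne j i with rfl | hj
    · simp [h]
    · simp [hj]
  rw [this]

theorem smul_var_of_eq_neg_one [MulSemiringAction Signs Ω]
    (hρ : ∀ (g : Signs) (f : Laurent l), g • algebraMap _ Ω f = algebraMap _ Ω (signHom ρ g f))
    {g : Signs} {i : Fin 3} (h : g i = -1) : (g • var l Ω i) * var l Ω i = 1 := by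
  rw [var, hρ, signHom_single, ← map_mul, AddMonoidAlgebra.single_mul_single, map_one, mul_one]
  have : g • (Pi.single i 1 : Fin 3 → ℤ) + Pi.single i 1 = 0 := by
    ext j
    rw [Pi.add_apply, signs_smul_apply]
    rcases eq_or_ne j i with rfl | hj
    · simp [h]
    · simp [hj]
  rw [this, ← AddMonoidAlgebra.one_def, map_one]

variable [Algebra l Ω] [IsScalarTower l (Laurent l) Ω]

theorem map_algebraMap (hτ : ∀ f : Laurent l, τ (algebraMap _ Ω f) = algebraMap _ Ω (negVars f))
    (c : l) : τ (algebraMap l Ω c) = algebraMap l Ω c := by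
  rw [IsScalarTower.algebraMap_apply l (Laurent l) Ω, hτ]
  congr 1
  refine (negVars_single 0 c).trans ?_
  simp

theorem smul_algebraMap [MulSemiringAction Signs Ω]
    (hρ : ∀ (g : Signs) (f : Laurent l), g • algebraMap _ Ω f = algebraMap _ Ω (signHom ρ g f))
    (g : Signs) (c : l) : g • (algebraMap l Ω c) = algebraMap l Ω (ρ g c) := by
  rw [IsScalarTower.algebraMap_apply l (Laurent l) Ω, hρ,
    IsScalarTower.algebraMap_apply l (Laurent l) Ω]
  congr 1
  refine (signHom_single ρ g 0 c).trans ?_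
  simp

theorem algebraicIndependent_var [IsFractionRing (Laurent l) Ω] :
    AlgebraicIndependent l (var l Ω) := by
  rw [algebraicIndependent_iff_injective_aeval]
  have h : ((aeval (var l Ω) : MvPolynomial (Fin 3) l →ₐ[l] Ω) : MvPolynomial (Fin 3) l →+* Ω) =
      (algebraMap (Laurent l) Ω).comp ofPolynomial := by
    apply MvPolynomial.ringHom_ext
    · intro c
      have : ofPolynomial (MvPolynomial.C c) = algebraMap l (Laurent l) c := by
        rw [← MvPolynomial.monomial_zero', ofPolynomial_monomial]
        simp
        rfl
      rw [RingHom.comp_apply, this, ← IsScalarTower.algebraMap_apply]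
      simp
    · intro i
      have : ofPolynomial (MvPolynomial.X i) =
          (AddMonoidAlgebra.single (Pi.single i 1) 1 : Laurent l) := by
        rw [MvPolynomial.X, ofPolynomial_monomial]
        congr 1
        ext j
        by_cases h : i = j <;> simp [h, eq_comm]
      simp [this, var]
  have h' : ⇑(aeval (var l Ω) : MvPolynomial (Fin 3) l →ₐ[l] Ω) =
      (algebraMap (Laurent l) Ω).comp ofPolynomial := congrArg DFunLike.coe h
  rw [h']
  exact (IsFractionRing.injective _ _).comp ofPolynomial_injective

end Embedding

end Laurent

namespace Laurent

section Embedding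

variable {k l Ω : Type*} [Field l] [Field Ω] [Algebra (Laurent l) Ω] {τ : Ω →+* Ω}
  {ρ : Signs →* RingAut l} [Algebra l Ω] [IsScalarTower l (Laurent l) Ω]
  [IsFractionRing (Laurent l) Ω] [Field k] [Algebra k l] [Algebra k Ω] [IsScalarTower k l Ω]
  [MulSemiringAction Signs Ω]

theorem exists_algHom (h2 : (2 : l) ≠ 0)
    (hτ : ∀ f : Laurent l, τ (algebraMap _ Ω f) = algebraMap _ Ω (negVars f))
    (hρ : ∀ (g : Signs) (f : Laurent l), g • algebraMap _ Ω f = algebraMap _ Ω (signHom ρ g f))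
    (hρk : ∀ g (c : k), ρ g (algebraMap k l c) = algebraMap k l c) {a : Fin 3 → k}
    (ha : ∀ i, a i ≠ 0) {s : Fin 3 → l} (hs : ∀ i, s i ^ 2 = algebraMap k l (a i))
    (hρs : ∀ g i, ρ g (s i) = ((g i : ℤ) : l) * s i)
    (σ : FractionRing (MvPolynomial (Fin 3) k) ≃ₐ[k] FractionRing (MvPolynomial (Fin 3) k))
    (hσ : ∀ i : Fin 3, σ (algebraMap (MvPolynomial (Fin 3) k) _ (X i)) =
      algebraMap k _ (a i) * (algebraMap (MvPolynomial (Fin 3) k) _ (X i))⁻¹) :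
    ∃ J : FractionRing (MvPolynomial (Fin 3) k) →ₐ[k] Ω, (∀ x, J (σ x) = τ (J x)) ∧
      (∀ (g : Signs) x, g • J x = J x) ∧
      ∀ i, ∃ m : Ω, m ≠ 0 ∧ τ m = m ∧ J (algebraMap (MvPolynomial (Fin 3) k) _ (X i) -
        algebraMap k _ (a i) * (algebraMap (MvPolynomial (Fin 3) k) _ (X i))⁻¹) =
        var l Ω i * m := by
  have h2Ω : (2 : Ω) ≠ 0 := by
    have := (_root_.map_ne_zero (algebraMap l Ω)).mpr h2
    rwa [map_ofNat] at this
  have hs0 (i) : s i ≠ 0 := fun h ↦ ha i (by simpa [h] using (hs i).symm)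
  let S (i : Fin 3) : Ω := algebraMap l Ω (s i)
  let Y (i : Fin 3) : Ω := var l Ω i
  have hS0 (i) : S i ≠ 0 := (_root_.map_ne_zero _).mpr (hs0 i)
  have hSS (i) : S i ^ 2 = algebraMap k Ω (a i) := by
    rw [← map_pow, hs, ← IsScalarTower.algebraMap_apply]
  have hτS (i) : τ (S i) = S i := map_algebraMap hτ _
  have hτY (i) : τ (Y i) = -Y i := map_var hτ i
  have hY0 (i) : Y i ≠ 0 := by
    exact (map_ne_zero_iff _ (IsFractionRing.injective _ _)).mpr
      (AddMonoidAlgebra.single_ne_zero.mpr one_ne_zero)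
  have hY1 (i) : 1 - Y i ≠ 0 := fun h ↦ by
    have h1 := hτY i
    rw [← sub_eq_zero.mp h, map_one] at h1
    exact h2Ω (by linear_combination h1)
  have hY2 (i) : 1 + Y i ≠ 0 := fun h ↦ by
    have h1 := hτY i
    rw [← neg_eq_of_add_eq_zero_right h, map_neg, map_one] at h1
    exact h2Ω (by linear_combination -h1)
  let z (i : Fin 3) : Ω := S i * (1 + Y i) / (1 - Y i)
  have hz0 (i) : z i ≠ 0 := div_ne_zero (mul_ne_zero (hS0 i) (hY2 i)) (hY1 i)
  have hz : AlgebraicIndependent k z := by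
    refine AlgebraicIndependent.restrictScalars (FaithfulSMul.algebraMap_injective k l)
      (AlgebraicIndependent.of_mem_adjoin (algebraicIndependent_var (l := l)) fun i ↦ ?_)
    have e : var l Ω i = (z i - S i) / (z i + S i) := by
      have : z i + S i ≠ 0 := by
        have : z i + S i = 2 * S i / (1 - Y i) := by
          have := hY1 i
          simp only [z]
          field_simp
          ring
        rw [this]
        exact div_ne_zero (mul_ne_zero h2Ω (hS0 i)) (hY1 i)
      rw [eq_div_iff this]
      have := hY1 i
      change Y i * _ = _
      simp only [z]
      field_simp
      ring
    rw [e]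
    have hzm : z i ∈ IntermediateField.adjoin l (Set.range z) :=
      IntermediateField.subset_adjoin _ _ ⟨i, rfl⟩
    have hSm : S i ∈ IntermediateField.adjoin l (Set.range z) :=
      IntermediateField.algebraMap_mem _ _
    exact div_mem (sub_mem hzm hSm) (add_mem hzm hSm)
  let J : FractionRing (MvPolynomial (Fin 3) k) →ₐ[k] Ω :=
    IsFractionRing.liftAlgHom (g := aeval z) hz
  have hJX (i) : J (algebraMap (MvPolynomial (Fin 3) k) _ (X i)) = z i := by
    exact (IsFractionRing.lift_algebraMap hz _).trans (MvPolynomial.aeval_X _ _)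
  have hext {f g : FractionRing (MvPolynomial (Fin 3) k) →+* Ω}
      (hC : ∀ c : k, f (algebraMap k _ c) = g (algebraMap k _ c))
      (hX : ∀ i, f (algebraMap (MvPolynomial (Fin 3) k) _ (X i)) =
        g (algebraMap (MvPolynomial (Fin 3) k) _ (X i))) : f = g := by
    apply IsLocalization.ringHom_ext (nonZeroDivisors (MvPolynomial (Fin 3) k))
    exact MvPolynomial.ringHom_ext hC hX
  have hτk (c : k) : τ (algebraMap k Ω c) = algebraMap k Ω c := by
    rw [IsScalarTower.algebraMap_apply k l Ω, map_algebraMap hτ]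
  have hgk (g : Signs) (c : k) : g • (algebraMap k Ω c) = algebraMap k Ω c := by
    rw [IsScalarTower.algebraMap_apply k l Ω, smul_algebraMap hρ, hρk]
  refine ⟨J, fun x ↦ ?_, fun g x ↦ ?_, fun i ↦ ?_⟩
  · have : (RingHomClass.toRingHom J).comp (RingHomClass.toRingHom σ) = τ.comp (RingHomClass.toRingHom J) := by
      refine hext (fun c ↦ by simp [hτk]) fun i ↦ ?_
      have h1 := hY1 i
      have h2 := hY2 i
      have h3 := hS0 i
      simp only [RingHom.comp_apply, RingHom.coe_coe, hσ, map_mul, map_inv₀, hJX, AlgHom.commutes,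
        ← hSS]
      simp only [z, map_div₀, map_mul, map_add, map_sub, map_one, hτS, hτY]
      rw [sub_neg_eq_add, ← sub_eq_add_neg]
      field_simp
    exact RingHom.congr_fun this x
  · have : (MulSemiringAction.toRingHom Signs Ω g).comp (RingHomClass.toRingHom J) = (RingHomClass.toRingHom J) := by
      refine hext (fun c ↦ by simp [hgk]) fun i ↦ ?_
      simp only [RingHom.comp_apply, RingHom.coe_coe, hJX, MulSemiringAction.toRingHom_apply]
      have h1 := hY1 i
      have hgS : g • S i = ((g i : ℤ) : Ω) * S i := by
        rw [smul_algebraMap hρ, hρs, map_mul, map_intCast]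
      simp only [z, smul_div₀', smul_mul', smul_add, smul_sub, smul_one, hgS]
      rcases Int.units_eq_one_or (g i) with hg | hg
      · have : g • Y i = Y i := smul_var_of_eq_one hρ hg
        rw [this, hg]
        simp
      · have : g • Y i = (Y i)⁻¹ := eq_inv_of_mul_eq_one_left (smul_var_of_eq_neg_one hρ hg)
        have h3 := hY0 i
        have h4 : Y i - 1 ≠ 0 := fun h ↦ h1 (by linear_combination -h)
        rw [this, hg]
        push_cast
        field_simp
        ring
    exact RingHom.congr_fun this x
  · have h1 := hY1 i
    have h2 := hY2 i
    have h3 := hS0 i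
    have h4 : (2 : Ω) ^ 2 ≠ 0 := pow_ne_zero 2 h2Ω
    refine ⟨2 ^ 2 * S i / ((1 + Y i) * (1 - Y i)), div_ne_zero (mul_ne_zero h4 h3)
      (mul_ne_zero h2 h1), ?_, ?_⟩
    · simp only [map_div₀, map_mul, map_add, map_sub, map_one, hτS, hτY, map_pow, map_ofNat]
      rw [sub_neg_eq_add, ← sub_eq_add_neg, mul_comm (1 - Y i)]
    · simp only [map_sub, map_mul, map_inv₀, hJX, AlgHom.commutes, ← hSS]
      change z i - _ = Y i * _
      simp only [z]
      field_simp
      ring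

end Embedding

end Laurent

theorem exists_field_eval_mul_eval_ne.{u, v} {k : Type u} {l : Type v} [Field k] [Field l] [Algebra k l]
    (h2 : (2 : k) ≠ 0) {ρ : Signs →* RingAut l}
    (hρk : ∀ g (c : k), ρ g (algebraMap k l c) = algebraMap k l c) {a : Fin 3 → k}
    (ha : ∀ i, a i ≠ 0) {s : Fin 3 → l} (hs : ∀ i, s i ^ 2 = algebraMap k l (a i))
    (hρs : ∀ g i, ρ g (s i) = ((g i : ℤ) : l) * s i)
    {σ : FractionRing (MvPolynomial (Fin 3) k) ≃ₐ[k] FractionRing (MvPolynomial (Fin 3) k)}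
    (hσ : ∀ i : Fin 3, σ (algebraMap (MvPolynomial (Fin 3) k) _ (X i)) =
      algebraMap k _ (a i) * (algebraMap (MvPolynomial (Fin 3) k) _ (X i))⁻¹) :
    ∃ (F : Type v) (_ : Field F) (_ : Algebra k F)
      (j : IntermediateField.fixedField (Subgroup.zpowers σ) →ₐ[k] F),
      ∀ P : F[X], P ≠ 0 → (∀ i, ∃ U V W : F[X], W ≠ 0 ∧
        U ^ 2 - P * V ^ 2 = Polynomial.C (algebraMap k F (a i)) * W ^ 2) →
      ∀ (i : Fin 3) (D : IntermediateField.fixedField (Subgroup.zpowers σ)),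
        (D : FractionRing (MvPolynomial (Fin 3) k)) =
          (algebraMap (MvPolynomial (Fin 3) k) _ (X i) -
            algebraMap k _ (a i) * (algebraMap (MvPolynomial (Fin 3) k) _ (X i))⁻¹) ^ 2 →
        ∀ c ≠ 0, P.eval 0 * P.eval 1 ≠ j D * c ^ 2 := by
  have h2l : (2 : l) ≠ 0 := by
    have := (_root_.map_ne_zero (algebraMap k l)).mpr h2
    rwa [map_ofNat] at this
  let Ω := FractionRing (Laurent l)
  let τ : Ω →+* Ω := (IsFractionRing.ringEquivOfRingEquiv (Laurent.negVars (l := l)) : Ω ≃+* Ω)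
  have hτ (f : Laurent l) : τ (algebraMap _ Ω f) = algebraMap _ Ω (Laurent.negVars f) :=
    IsFractionRing.ringEquivOfRingEquiv_algebraMap _ _
  let _ : MulSemiringAction Signs (Laurent l) := Laurent.signsAction ρ
  let _ : MulSemiringAction Signs Ω := IsFractionRing.mulSemiringAction Signs (Laurent l) Ω
  have hρ (g : Signs) (f : Laurent l) :
      g • algebraMap _ Ω f = algebraMap _ Ω (Laurent.signHom ρ g f) :=
    IsFractionRing.ringEquivOfRingEquiv_algebraMap _ _
  obtain ⟨J, hJσ, hJg, hJX⟩ := Laurent.exists_algHom h2l hτ hρ hρk ha hs hρs σ hσ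
  have hτk (c : k) : τ (algebraMap k Ω c) = algebraMap k Ω c := by
    rw [← J.commutes, ← hJσ, AlgEquiv.commutes]
  have hgk (g : Signs) (c : k) : g • (algebraMap k Ω c) = algebraMap k Ω c := by
    rw [← J.commutes, hJg]
  let F : Subfield Ω := τ.eqLocusField (RingHom.id Ω) ⊓ FixedPoints.subfield Signs Ω
  have hF (x : Ω) : x ∈ F ↔ τ x = x ∧ ∀ g : Signs, g • x = x := Iff.rfl
  let iF : k →+* F := (algebraMap k Ω).codRestrict F fun c ↦ (hF _).mpr ⟨hτk c, fun g ↦ hgk g c⟩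
  let _ : Algebra k F := iF.toAlgebra
  let j : IntermediateField.fixedField (Subgroup.zpowers σ) →ₐ[k] F :=
    { toRingHom := ((J : FractionRing (MvPolynomial (Fin 3) k) →+* Ω).comp
        (algebraMap (IntermediateField.fixedField (Subgroup.zpowers σ)) _)).codRestrict F
        fun x ↦ (hF _).mpr ⟨by
          have : σ x = x := (IntermediateField.mem_fixedField_iff _ _).mp x.2 σ
            (Subgroup.mem_zpowers σ)
          refine (hJσ x).symm.trans ?_
          rw [this]
          rfl, fun g ↦ hJg g x⟩
      commutes' := fun c ↦ Subtype.ext (J.commutes c) }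
  refine ⟨F, inferInstance, inferInstance, j, fun P hP hPt i D hD c hc he ↦ ?_⟩
  obtain ⟨m, hm0, hm, hJm⟩ := hJX i
  have hc0 : (c : Ω) ≠ 0 := fun h ↦ hc (Subtype.ext h)
  have hcF := (hF c).mp c.2
  refine Laurent.eval_mul_eval_ne h2l hτ hρ hF (s := fun i ↦ algebraMap l Ω (s i))
    (t := fun i ↦ iF (a i)) (fun i h ↦ ha i ?_) (fun i ↦ Laurent.map_algebraMap hτ _)
    (fun g i ↦ ?_) (fun i ↦ ?_) hP hPt (mul_ne_zero hm0 hc0)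
    (by rw [map_mul, hm, hcF.1]) i ?_
  · rw [_root_.map_eq_zero] at h
    simpa [h] using (hs i).symm
  · rw [Laurent.smul_algebraMap hρ, hρs, map_mul, map_intCast]
  · rw [← map_pow, hs, ← IsScalarTower.algebraMap_apply]
    rfl
  · rw [he]
    change J D * (c : Ω) ^ 2 = _
    rw [hD, map_pow, hJm, Laurent.var]
    ring

theorem card_eq_eight_of_prod_ne_one {Γ : Type*} [Group Γ] [Fintype Γ] {χ : Γ →* Signs}
    (hχ : Function.Injective χ)
    (h : ∀ I : Finset (Fin 3), I.Nonempty → ∃ g, ∏ i ∈ I, χ g i ≠ 1) : Fintype.card Γ = 8 := by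
  classical
  have h1 (I : Finset (Fin 3)) : ∑ g, ((∏ i ∈ I, χ g i : ℤˣ) : ℤ) =
      if I = ∅ then (Fintype.card Γ : ℤ) else 0 := by
    split_ifs with hI
    · simp [hI]
    · obtain ⟨g, hg⟩ := h I (Finset.nonempty_iff_ne_empty.mpr hI)
      refine sum_hom_units_eq_zero ((Units.coeHom ℤ).comp
        (⟨⟨fun g ↦ ∏ i ∈ I, χ g i, by simp⟩, fun x y ↦ by simp [Finset.prod_mul_distrib]⟩ :
          Γ →* ℤˣ)) fun h0 ↦ hg (Units.ext (DFunLike.congr_fun h0 g))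
  have h2 (g : Γ) : ∏ i, (1 + (χ g i : ℤ)) = if g = 1 then 8 else 0 := by
    split_ifs with hg
    · simp [hg]
    · obtain ⟨i, hi⟩ := Function.ne_iff.mp (fun h ↦ hg (hχ (h.trans (map_one χ).symm)))
      refine Finset.prod_eq_zero (Finset.mem_univ i) ?_
      simp [(Int.units_eq_one_or (χ g i)).resolve_left hi]
  have h3 : ∑ g : Γ, ∏ i, (1 + (χ g i : ℤ)) = 8 := by simp [h2]
  simp_rw [Finset.prod_one_add] at h3
  rw [Finset.sum_comm] at h3
  have h4 : ∑ I ∈ (Finset.univ : Finset (Fin 3)).powerset, ∑ g, ((∏ i ∈ I, χ g i : ℤˣ) : ℤ) = 8 := by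
    rw [← h3]
    simp
  simp_rw [h1] at h4
  simp only [Finset.sum_ite_eq', Finset.empty_mem_powerset, if_true] at h4
  exact_mod_cast h4

section SignCharacter

variable {k l : Type*} [Field k] [Field l] [Algebra k l] {a : Fin 3 → k} {s : Fin 3 → l}

theorem units_cast_injective (h2 : (2 : l) ≠ 0) {u v : ℤˣ} (h : ((u : ℤ) : l) = ((v : ℤ) : l)) :
    u = v := by
  rcases Int.units_eq_one_or u with rfl | rfl <;> rcases Int.units_eq_one_or v with rfl | rfl
  · rfl
  · exact absurd (by push_cast at h; linear_combination h) h2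
  · exact absurd (by push_cast at h; linear_combination -h) h2
  · rfl

theorem exists_sign_character (h2 : (2 : l) ≠ 0) (hs0 : ∀ i, s i ≠ 0)
    (hs : ∀ i, s i ^ 2 = algebraMap k l (a i)) (hl : Algebra.adjoin k (Set.range s) = ⊤) :
    ∃ χ : Gal(l/k) →* Signs, Function.Injective χ ∧ ∀ g i, g (s i) = ((χ g i : ℤ) : l) * s i := by
  have h (g : Gal(l/k)) (i : Fin 3) : ∃ e : ℤˣ, g (s i) = ((e : ℤ) : l) * s i := by
    have : g (s i) ^ 2 = s i ^ 2 := by rw [← map_pow, hs, AlgEquiv.commutes]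
    rcases sq_eq_sq_iff_eq_or_eq_neg.mp this with h | h
    · exact ⟨1, by simp [h]⟩
    · exact ⟨-1, by simp [h]⟩
  choose e he using h
  refine ⟨MonoidHom.mk' e fun g g' ↦ funext fun i ↦ units_cast_injective h2 ?_, ?_, he⟩
  · apply mul_right_cancel₀ (hs0 i)
    rw [← he, AlgEquiv.mul_apply, he, map_mul, he, map_intCast]
    push_cast [Pi.mul_apply]
    ring
  · intro g g' hgg'
    have hgg (i) : e g i = e g' i := congrFun hgg' i
    have : Set.EqOn (g : l →ₐ[k] l) (g' : l →ₐ[k] l) (Set.range s) := by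
      rintro _ ⟨i, rfl⟩
      change g (s i) = g' (s i)
      rw [he, he, hgg]
    have := AlgHom.ext_of_adjoin_eq_top hl this
    exact AlgEquiv.ext fun x ↦ DFunLike.congr_fun this x

theorem exists_ringAut_of_finrank_eq [FiniteDimensional k l] [IsGalois k l] (h2 : (2 : l) ≠ 0)
    (hs0 : ∀ i, s i ≠ 0) (hs : ∀ i, s i ^ 2 = algebraMap k l (a i))
    (hl : Algebra.adjoin k (Set.range s) = ⊤) (h8 : Module.finrank k l = 8) :
    ∃ ρ : Signs →* RingAut l, (∀ g (c : k), ρ g (algebraMap k l c) = algebraMap k l c) ∧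
      ∀ g i, ρ g (s i) = ((g i : ℤ) : l) * s i := by
  obtain ⟨χ, hχ, hχs⟩ := exists_sign_character h2 hs0 hs hl
  have hb : Function.Bijective χ := by
    refine (Nat.bijective_iff_injective_and_card χ).mpr ⟨hχ, ?_⟩
    rw [IsGalois.card_aut_eq_finrank, h8]
    simp
  let ε := MulEquiv.ofBijective χ hb
  refine ⟨(MulSemiringAction.toRingAut Gal(l/k) l).comp ε.symm.toMonoidHom,
    fun g c ↦ (ε.symm g).commutes c, fun g i ↦ (hχs (ε.symm g) i).trans ?_⟩
  rw [show χ (ε.symm g) = g from ε.apply_symm_apply g]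

theorem exists_prod_eq_sq_of_finrank_ne [FiniteDimensional k l] [IsGalois k l] (h2 : (2 : l) ≠ 0)
    (hs0 : ∀ i, s i ≠ 0) (hs : ∀ i, s i ^ 2 = algebraMap k l (a i))
    (hl : Algebra.adjoin k (Set.range s) = ⊤) (h8 : Module.finrank k l ≠ 8) :
    ∃ I : Finset (Fin 3), I.Nonempty ∧ ∃ b : k, ∏ i ∈ I, a i = b ^ 2 := by
  obtain ⟨χ, hχ, hχs⟩ := exists_sign_character h2 hs0 hs hl
  have := Fintype.ofFinite Gal(l/k)
  by_contra! hI
  refine h8 ?_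
  rw [← IsGalois.card_aut_eq_finrank, Nat.card_eq_fintype_card]
  refine card_eq_eight_of_prod_ne_one hχ fun I hIn ↦ ?_
  by_contra! hg
  obtain ⟨b, hb⟩ := (IsGalois.mem_range_algebraMap_iff_fixed (F := k) (∏ i ∈ I, s i)).mpr
    fun g ↦ by
      rw [map_prod]
      simp_rw [hχs]
      rw [Finset.prod_mul_distrib]
      have := congrArg (fun u : ℤˣ ↦ ((u : ℤ) : l)) (hg g)
      push_cast at this
      rw [this, one_mul]
  refine hI I hIn b ((algebraMap k l).injective ?_)
  rw [map_pow, hb, map_prod, ← Finset.prod_pow]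
  simp_rw [hs]

end SignCharacter

theorem exists_sqrt_splittingField {k : Type*} [Field k] (h2 : (2 : k) ≠ 0) {a : Fin 3 → k}
    (ha : ∀ i, a i ≠ 0) {p : k[X]} (hp : p = ∏ i, (Polynomial.X ^ 2 - Polynomial.C (a i))) :
    IsGalois k p.SplittingField ∧ ∃ s : Fin 3 → p.SplittingField,
      (∀ i, s i ^ 2 = algebraMap k _ (a i)) ∧ Algebra.adjoin k (Set.range s) = ⊤ := by
  have hdvd (i) : (Polynomial.X ^ 2 - Polynomial.C (a i)) ∣ p :=
    hp ▸ Finset.dvd_prod_of_mem _ (Finset.mem_univ i)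
  have hp0 : p ≠ 0 := hp ▸ Finset.prod_ne_zero_iff.mpr
    fun i _ ↦ Polynomial.X_pow_sub_C_ne_zero two_pos _
  have hroot (i) : ∃ x : p.SplittingField, x ^ 2 = algebraMap k _ (a i) := by
    have h1 := (Polynomial.SplittingField.splits p).of_dvd
      (Polynomial.map_ne_zero hp0) (Polynomial.map_dvd _ (hdvd i))
    obtain ⟨x, hx⟩ := h1.exists_eval_eq_zero (by
      rw [Polynomial.degree_map, Polynomial.degree_X_pow_sub_C two_pos]
      decide)
    exact ⟨x, by simpa [sub_eq_zero] using hx⟩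
  choose s hs using hroot
  have hadj : Algebra.adjoin k (Set.range s) = ⊤ := by
    rw [eq_top_iff, ← Polynomial.SplittingField.adjoin_rootSet p]
    refine Algebra.adjoin_le fun x hx ↦ ?_
    have hx := (congrArg (Polynomial.aeval x) hp).symm.trans
      ((Polynomial.mem_rootSet_of_ne hp0).mp hx)
    rw [map_prod, Finset.prod_eq_zero_iff] at hx
    obtain ⟨i, -, hi⟩ := hx
    have hi : x ^ 2 = s i ^ 2 := by simpa [sub_eq_zero, hs] using hi
    have hm : s i ∈ Algebra.adjoin k (Set.range s) := Algebra.subset_adjoin ⟨i, rfl⟩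
    rcases sq_eq_sq_iff_eq_or_eq_neg.mp hi with h | h
    · exact h ▸ hm
    · exact h ▸ neg_mem hm
  have hsep : Algebra.IsSeparable k p.SplittingField := by
    rw [← separableClosure.eq_top_iff, eq_top_iff,
      ← IntermediateField.adjoin_eq_top_of_algebra k _ hadj, IntermediateField.adjoin_le_iff]
    rintro _ ⟨i, rfl⟩
    change s i ∈ separableClosure k _
    rw [mem_separableClosure_iff]
    refine Polynomial.Separable.of_dvd (Polynomial.separable_X_pow_sub_C (a i) (n := 2)
      (by exact_mod_cast h2) (ha i)) (minpoly.dvd _ _ ?_)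
    simp [hs]
  have : Normal k p.SplittingField := Normal.of_isSplittingField p
  exact ⟨⟨⟩, s, hs, hadj⟩

/-- A finitely generated subalgebra of a rational function field over an infinite field has a
rational point. -/
theorem Subalgebra.FG.nonempty_algHom_of_infinite {ι k : Type*} [Field k] [Infinite k]
    {B : Subalgebra k (FractionRing (MvPolynomial ι k))} (hB : B.FG) : Nonempty (B →ₐ[k] k) := by
  obtain ⟨S, rfl⟩ := hB
  obtain ⟨b, hb⟩ := IsLocalization.exist_integer_multiples_of_finset
    (nonZeroDivisors (MvPolynomial ι k)) S
  have hb0 : (b : MvPolynomial ι k) ≠ 0 := nonZeroDivisors.ne_zero b.2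
  obtain ⟨x, hx⟩ : ∃ x : ι → k, MvPolynomial.eval x (b : MvPolynomial ι k) ≠ 0 := by
    by_contra! h
    exact hb0 (MvPolynomial.funext fun x ↦ by rw [h, map_zero])
  let M : Submonoid (MvPolynomial ι k) :=
    (nonZeroDivisors k).comap (MvPolynomial.eval x)
  have hM : M ≤ nonZeroDivisors (MvPolynomial ι k) := fun q hq ↦
    mem_nonZeroDivisors_of_ne_zero fun h0 ↦ nonZeroDivisors.ne_zero hq (by rw [h0, map_zero])
  let R := Localization.subalgebra.ofField (FractionRing (MvPolynomial ι k)) M hM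
  let ev : R →+* k := IsLocalization.lift (M := M) (g := MvPolynomial.eval x)
    fun y ↦ (nonZeroDivisors.ne_zero y.2).isUnit
  let R' := R.restrictScalars k
  have hle : Algebra.adjoin k (S : Set (FractionRing (MvPolynomial ι k))) ≤ R' := by
    refine Algebra.adjoin_le fun g hg ↦ ?_
    obtain ⟨c, hc⟩ := hb g hg
    refine ⟨c, b, mem_nonZeroDivisors_of_ne_zero hx, ?_⟩
    rw [hc, Algebra.smul_def]
    have : algebraMap (MvPolynomial ι k) (FractionRing (MvPolynomial ι k)) b ≠ 0 := by
      simp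
    change _ = algebraMap (MvPolynomial ι k) (FractionRing (MvPolynomial ι k)) b * _ * _
    field_simp
  let ev' : R' →ₐ[k] k :=
    { toRingHom := ev
      commutes' := fun c ↦ (IsLocalization.lift_eq _ (MvPolynomial.C c)).trans
        (MvPolynomial.eval_C c) }
  exact ⟨ev'.comp (Subalgebra.inclusion hle)⟩

theorem exists_norm_form_of_isFractionRing {k L : Type*} [Field k] [Field L] [Algebra k L]
    {A : Subalgebra k L} [IsFractionRing A L] {d₁ d₂ : A} (hd₂ : d₂ ≠ 0) {c : k}
    (h : ∃ U V W : L, W ≠ 0 ∧ U ^ 2 - (d₁ / d₂ : L) * V ^ 2 = algebraMap k L c * W ^ 2) :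
    ∃ U V W : A, W ≠ 0 ∧ U ^ 2 - d₁ * d₂ * V ^ 2 = algebraMap k A c * W ^ 2 := by
  obtain ⟨U, V, W, hW, he⟩ := h
  obtain ⟨u₁, u₂, hu₂, rfl⟩ := IsFractionRing.div_surjective A U
  obtain ⟨v₁, v₂, hv₂, rfl⟩ := IsFractionRing.div_surjective A V
  obtain ⟨w₁, w₂, hw₂, rfl⟩ := IsFractionRing.div_surjective A W
  have hw₁ : w₁ ≠ 0 := by rintro rfl; simp at hW
  replace hu₂ : u₂ ≠ 0 := nonZeroDivisors.ne_zero hu₂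
  replace hv₂ : v₂ ≠ 0 := nonZeroDivisors.ne_zero hv₂
  replace hw₂ : w₂ ≠ 0 := nonZeroDivisors.ne_zero hw₂
  refine ⟨u₁ * v₂ * w₂ * d₂, v₁ * u₂ * w₂, w₁ * u₂ * v₂ * d₂, by simp [*], Subtype.ext ?_⟩
  have e₁ : (u₂ : L) ≠ 0 := by simpa using hu₂
  have e₂ : (v₂ : L) ≠ 0 := by simpa using hv₂
  have e₃ : (w₂ : L) ≠ 0 := by simpa using hw₂
  have e₄ : (d₂ : L) ≠ 0 := by simpa using hd₂
  change ((u₁ / u₂ : L)) ^ 2 - d₁ / d₂ * (v₁ / v₂) ^ 2 = _ * (w₁ / w₂ : L) ^ 2 at he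
  field_simp at he
  push_cast
  change _ = algebraMap k L c * _
  linear_combination (d₂ : L) * he

set_option maxHeartbeats 800000 in
theorem exists_polynomial_of_isRetractRational {ι k L K F : Type*} [Field k] [Field L] [Field K]
    [Field F] [Algebra k L] [Algebra k K] [Algebra L K] [IsScalarTower k L K] [Algebra k F]
    (hK : ∀ B : Subalgebra k K, B.FG → Nonempty (B →ₐ[k] k)) (hL : IsRetractRational k L)
    (j : L →ₐ[k] F) {D : L} {w : K} (hw0 : w ≠ 0) (hw : algebraMap L K D = w ^ 2) {a : ι → k}
    (ha : ∀ i, ∃ U V W : L, W ≠ 0 ∧ U ^ 2 - D * V ^ 2 = algebraMap k L (a i) * W ^ 2) :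
    ∃ P : F[X], P ≠ 0 ∧ (∀ i, ∃ U V W : F[X], W ≠ 0 ∧
      U ^ 2 - P * V ^ 2 = Polynomial.C (algebraMap k F (a i)) * W ^ 2) ∧
      ∃ c : F, c ≠ 0 ∧ P.eval 0 * P.eval 1 = j D * c ^ 2 := by
  obtain ⟨A, hA, n, f, hf, φ, ψ, hψφ⟩ := hL
  obtain ⟨d₁, d₂, hd₂, rfl⟩ := IsFractionRing.div_surjective A D
  replace hd₂ : d₂ ≠ 0 := nonZeroDivisors.ne_zero hd₂
  have hψφ (x : A) : ψ (φ x) = x := DFunLike.congr_fun hψφ x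
  let R := MvPolynomial (Fin n) k
  let d : K := w * algebraMap L K d₂
  have hd0 : d ≠ 0 := mul_ne_zero hw0 (by simpa using hd₂)
  have hd : algebraMap L K ((d₁ * d₂ : A) : L) = d ^ 2 := by
    have h2 : ((d₂ : A) : L) ≠ 0 := by simpa using hd₂
    have : ((d₁ * d₂ : A) : L) = (d₁ / d₂ : L) * (d₂ : L) ^ 2 := by
      push_cast
      field_simp
    rw [this, map_mul, map_pow, mul_pow]
    exact congrArg (· * _) hw
  let iK : A →ₐ[k] K := (IsScalarTower.toAlgHom k L K).comp A.val
  let B : Subalgebra k K := Algebra.adjoin k {d, d⁻¹} ⊔ iK.range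
  have hAfg : iK.range.FG := by
    have h1 : Algebra.FiniteType k (Localization.Away f) := inferInstance
    have h2 : Algebra.FiniteType k A := h1.of_surjective ψ fun x ↦ ⟨φ x, hψφ x⟩
    exact (Subalgebra.fg_iff_finiteType _).mpr
      (h2.of_surjective iK.rangeRestrict iK.rangeRestrict_surjective)
  obtain ⟨ev⟩ := hK B (Subalgebra.FG.sup (Subalgebra.fg_def.mpr ⟨{d, d⁻¹}, by simp, rfl⟩) hAfg)
  have hiB (x : A) : iK x ∈ B := (le_sup_right : _ ≤ B) ⟨x, rfl⟩
  have hdB : d ∈ B := (le_sup_left : _ ≤ B) (Algebra.subset_adjoin (by simp))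
  have hdB' : d⁻¹ ∈ B := (le_sup_left : _ ≤ B) (Algebra.subset_adjoin (by simp))
  have hev0 : ev ⟨d, hdB⟩ ≠ 0 := by
    intro h
    have h1 : (⟨d, hdB⟩ : B) * ⟨d⁻¹, hdB'⟩ = 1 := Subtype.ext (mul_inv_cancel₀ hd0)
    have h2 := congrArg ev h1
    rw [map_mul, h, zero_mul, map_one] at h2
    exact zero_ne_one h2
  let e : A →ₐ[k] k := ev.comp (iK.codRestrict B hiB)
  have he : e (d₁ * d₂) = ev ⟨d, hdB⟩ ^ 2 := by
    rw [← map_pow]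
    exact congrArg ev (Subtype.ext hd)
  let Θ₀ : Localization.Away f →ₐ[k] F := (Algebra.ofId k F).comp (e.comp ψ)
  let Θ₁ : Localization.Away f →ₐ[k] F := (j.comp A.val).comp ψ
  have hΘ₀ (x : A) : Θ₀ (φ x) = algebraMap k F (e x) := congrArg (fun y ↦ algebraMap k F (e y)) (hψφ x)
  have hΘ₁ (x : A) : Θ₁ (φ x) = j x := congrArg (fun y : A ↦ j y) (hψφ x)
  let ι₀ := algebraMap R (Localization.Away f)
  let γ : R →ₐ[k] F[X] := MvPolynomial.aeval fun i ↦ Polynomial.C (Θ₀ (ι₀ (X i))) +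
    Polynomial.X * Polynomial.C (Θ₁ (ι₀ (X i)) - Θ₀ (ι₀ (X i)))
  have hγ₀ (p : R) : (γ p).eval 0 = Θ₀ (ι₀ p) := by
    have : ((Polynomial.aeval (0 : F)).restrictScalars k).comp γ =
        Θ₀.comp (IsScalarTower.toAlgHom k R (Localization.Away f)) := by
      ext i
      simp [γ, ι₀]
      rfl
    exact DFunLike.congr_fun this p
  have hγ₁ (p : R) : (γ p).eval 1 = Θ₁ (ι₀ p) := by
    have : ((Polynomial.aeval (1 : F)).restrictScalars k).comp γ =
        Θ₁.comp (IsScalarTower.toAlgHom k R (Localization.Away f)) := by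
      ext i
      simp [γ, ι₀]
      rfl
    exact DFunLike.congr_fun this p
  have hι₀ : Function.Injective ι₀ :=
    IsLocalization.injective _ (powers_le_nonZeroDivisors_of_noZeroDivisors hf)
  have hfrac (z : Localization.Away f) : ∃ q p : R, IsUnit (ι₀ q) ∧ z * ι₀ q = ι₀ p := by
    obtain ⟨⟨p, q⟩, h⟩ := IsLocalization.surj (Submonoid.powers f) z
    exact ⟨q, p, IsLocalization.map_units _ q, h⟩
  obtain ⟨q, p, hq, hp⟩ := hfrac (φ (d₁ * d₂))
  have hΘq₀ : Θ₀ (ι₀ q) ≠ 0 := (hq.map Θ₀).ne_zero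
  have hΘq₁ : Θ₁ (ι₀ q) ≠ 0 := (hq.map Θ₁).ne_zero
  have hp0 : Θ₀ (ι₀ (p * q)) = algebraMap k F (ev ⟨d, hdB⟩) ^ 2 * Θ₀ (ι₀ q) ^ 2 := by
    rw [map_mul, ← hp, map_mul, map_mul, hΘ₀, he, map_pow]
    ring
  have hjd₂ : j d₂ ≠ 0 := by simpa using hd₂
  have hp1 : Θ₁ (ι₀ (p * q)) = j (d₁ / d₂) * j d₂ ^ 2 * Θ₁ (ι₀ q) ^ 2 := by
    rw [map_mul, ← hp, map_mul, map_mul, hΘ₁, map_div₀]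
    push_cast
    rw [map_mul]
    field_simp
  have hD0 : j (d₁ / d₂ : L) ≠ 0 := by
    rw [_root_.map_ne_zero, ← _root_.map_ne_zero (algebraMap L K)]
    exact ne_of_eq_of_ne hw (pow_ne_zero 2 hw0)
  refine ⟨γ (p * q), fun h ↦ ?_, fun i ↦ ?_, algebraMap k F (ev ⟨d, hdB⟩) * Θ₀ (ι₀ q) * j d₂ *
    Θ₁ (ι₀ q), by simp [*], ?_⟩
  · have := hγ₁ (p * q)
    rw [h, Polynomial.eval_zero, hp1] at this
    exact mul_ne_zero (mul_ne_zero hD0 (pow_ne_zero 2 hjd₂)) (pow_ne_zero 2 hΘq₁) this.symm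
  · obtain ⟨U, V, W, hW, hUVW⟩ := exists_norm_form_of_isFractionRing hd₂ (ha i)
    obtain ⟨qU, pU, hqU, hpU⟩ := hfrac (φ U)
    obtain ⟨qV, pV, hqV, hpV⟩ := hfrac (φ V)
    obtain ⟨qW, pW, hqW, hpW⟩ := hfrac (φ W)
    refine ⟨γ (pU * qV * qW * q), γ (pV * qU * qW), γ (pW * qU * qV * q), fun h ↦ ?_, ?_⟩
    · have := hγ₁ (pW * qU * qV * q)
      simp only [h, Polynomial.eval_zero, map_mul, ← hpW, hΘ₁] at this
      refine mul_ne_zero (mul_ne_zero (mul_ne_zero (mul_ne_zero ?_ (hqW.map Θ₁).ne_zero)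
        (hqU.map Θ₁).ne_zero) (hqV.map Θ₁).ne_zero) hΘq₁ this.symm
      simpa using hW
    · have hφ := congrArg φ hUVW
      simp only [map_sub, map_mul, map_pow, AlgHom.commutes] at hφ
      have hp' : φ d₁ * φ d₂ * ι₀ q = ι₀ p := by rw [← map_mul, hp]
      have : (pU * qV * qW * q) ^ 2 - (p * q) * (pV * qU * qW) ^ 2 =
          algebraMap k R (a i) * (pW * qU * qV * q) ^ 2 := by
        apply hι₀
        have hc : ι₀ (algebraMap k R (a i)) = algebraMap k _ (a i) :=
          (IsScalarTower.algebraMap_apply k R _ _).symm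
        simp only [map_sub, map_mul, map_pow, ← hpU, ← hpV, ← hpW, ← hp', hc]
        linear_combination (ι₀ qU * ι₀ qV * ι₀ qW * ι₀ q) ^ 2 * hφ
      have := congrArg γ this
      rw [map_sub, map_mul γ (p * q), map_mul γ (algebraMap k R _), map_pow, map_pow, map_pow,
        AlgHom.commutes] at this
      exact this
  · rw [hγ₀, hγ₁, hp0, hp1]
    change _ = j (d₁ / d₂) * _
    ring

theorem infinite_of_signs {k l : Type*} [Field k] [Field l] [Algebra k l] (h2 : (2 : k) ≠ 0)
    {ρ : Signs →* RingAut l} (hρk : ∀ g (c : k), ρ g (algebraMap k l c) = algebraMap k l c)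
    {a : Fin 3 → k} (ha : ∀ i, a i ≠ 0) {s : Fin 3 → l} (hs : ∀ i, s i ^ 2 = algebraMap k l (a i))
    (hρs : ∀ g i, ρ g (s i) = ((g i : ℤ) : l) * s i) : Infinite k := by
  by_contra hk
  have : Finite k := not_infinite_iff_finite.mp hk
  have := Fintype.ofFinite k
  classical
  have hl2 : (2 : l) ≠ 0 := by
    rw [← map_ofNat (algebraMap k l)]
    simpa using h2
  have key {c : k} (hc : c ≠ 0) {x : l} (hx : x ^ 2 = algebraMap k l c) {g : Signs}
      (hg : ρ g x = -x) : quadraticChar k c = -1 := by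
    rw [quadraticChar_neg_one_iff_not_isSquare]
    rintro ⟨b, rfl⟩
    have hfix : ρ g x = x := by
      rw [map_mul, ← sq] at hx
      rcases sq_eq_sq_iff_eq_or_eq_neg.mp hx with rfl | rfl
      · exact hρk g b
      · rw [map_neg, hρk]
    have h0 : x = 0 := by
      have : 2 * x = 0 := by linear_combination hg - hfix
      simpa [hl2] using this
    rw [h0, zero_pow two_ne_zero, eq_comm, _root_.map_eq_zero] at hx
    exact hc hx
  have h01 := key (mul_ne_zero (ha 0) (ha 1)) (x := s 0 * s 1) (g := Pi.mulSingle 0 (-1))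
    (by rw [mul_pow, hs, hs, map_mul]) (by simp [hρs])
  have h0 := key (ha 0) (hs 0) (g := Pi.mulSingle 0 (-1)) (by simp [hρs])
  have h1 := key (ha 1) (hs 1) (g := Pi.mulSingle 1 (-1)) (by simp [hρs])
  rw [map_mul, h0, h1] at h01
  norm_num at h01

theorem mem_fixedField_zpowers {k K : Type*} [Field k] [Field K] [Algebra k K] {σ : K ≃ₐ[k] K}
    {x : K} (h : σ x = x) : x ∈ IntermediateField.fixedField (Subgroup.zpowers σ) := by
  rw [IntermediateField.mem_fixedField_iff]
  intro f hf
  have : Subgroup.zpowers σ ≤ MulAction.stabilizer (K ≃ₐ[k] K) x := by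
    rw [Subgroup.zpowers_le]
    exact h
  exact this hf

theorem sub_div_var_ne_zero {ι k : Type*} [Field k] (c : k) (i : ι) :
    algebraMap (MvPolynomial ι k) (FractionRing (MvPolynomial ι k)) (MvPolynomial.X i) -
      algebraMap k _ c * (algebraMap (MvPolynomial ι k) _ (MvPolynomial.X i))⁻¹ ≠ 0 := by
  intro h
  have hx : algebraMap (MvPolynomial ι k) (FractionRing (MvPolynomial ι k))
      (MvPolynomial.X i) ≠ 0 := by simp
  rw [sub_eq_zero, eq_mul_inv_iff_mul_eq₀ hx,
    IsScalarTower.algebraMap_apply k (MvPolynomial ι k), ← map_mul,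
    (IsFractionRing.injective (MvPolynomial ι k) (FractionRing (MvPolynomial ι k))).eq_iff] at h
  have := congrArg MvPolynomial.totalDegree h
  rw [MvPolynomial.algebraMap_eq, MvPolynomial.totalDegree_C, ← sq,
    MvPolynomial.totalDegree_X_pow] at this
  exact two_ne_zero this

theorem not_isRetractRational_fixedField {k l : Type*} [Field k] [Field l] [Algebra k l]
    (h2 : (2 : k) ≠ 0)
    {ρ : Signs →* RingAut l} (hρk : ∀ g (c : k), ρ g (algebraMap k l c) = algebraMap k l c)
    {a : Fin 3 → k} (ha : ∀ i, a i ≠ 0) {s : Fin 3 → l} (hs : ∀ i, s i ^ 2 = algebraMap k l (a i))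
    (hρs : ∀ g i, ρ g (s i) = ((g i : ℤ) : l) * s i)
    {σ : FractionRing (MvPolynomial (Fin 3) k) ≃ₐ[k] FractionRing (MvPolynomial (Fin 3) k)}
    (hσ : ∀ i : Fin 3, σ (algebraMap (MvPolynomial (Fin 3) k) _ (MvPolynomial.X i)) =
      algebraMap k _ (a i) * (algebraMap (MvPolynomial (Fin 3) k) _ (MvPolynomial.X i))⁻¹) :
    ¬ IsRetractRational k (IntermediateField.fixedField (Subgroup.zpowers σ)) := by
  intro hR
  have hk := infinite_of_signs h2 hρk ha hs hρs
  obtain ⟨F, _, _, j, hj⟩ := exists_field_eval_mul_eval_ne h2 hρk ha hs hρs hσ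
  let K := FractionRing (MvPolynomial (Fin 3) k)
  let x (i : Fin 3) : K := algebraMap (MvPolynomial (Fin 3) k) _ (MvPolynomial.X i)
  have hx (i) : x i ≠ 0 := by simp [x]
  have hc (i) : algebraMap k K (a i) ≠ 0 := by simpa using ha i
  let w (i : Fin 3) : K := x i - algebraMap k K (a i) * (x i)⁻¹
  let u (i : Fin 3) : K := x i + algebraMap k K (a i) * (x i)⁻¹
  have hw0 (i) : w i ≠ 0 := sub_div_var_ne_zero _ _
  have hσ' (i) : σ (x i) = algebraMap k K (a i) * (x i)⁻¹ := hσ i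
  have hσc (c : k) : σ (algebraMap k K c) = algebraMap k K c := σ.commutes c
  have hw (i) : σ (w i) = -w i := by
    simp only [w, map_sub, map_mul, map_inv₀, hσc, hσ']
    have := hx i
    have := hc i
    field_simp
    ring
  have hu (i) : σ (u i) = u i := by
    simp only [u, map_add, map_mul, map_inv₀, hσc, hσ']
    have := hx i
    have := hc i
    field_simp
    ring
  let D : IntermediateField.fixedField (Subgroup.zpowers σ) :=
    ⟨w 0 ^ 2, mem_fixedField_zpowers (by rw [map_pow, hw, neg_sq])⟩
  have h2K : (2 : IntermediateField.fixedField (Subgroup.zpowers σ)) ≠ 0 := by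
    have h := (_root_.map_ne_zero (algebraMap k
      (IntermediateField.fixedField (Subgroup.zpowers σ)))).mpr h2
    rwa [map_ofNat] at h
  obtain ⟨P, hP0, hP, c, hc0, hPc⟩ := exists_polynomial_of_isRetractRational (a := a)
    (K := K) (D := D) (w := w 0)
    (fun B hB ↦ hB.nonempty_algHom_of_infinite) hR j (hw0 0) rfl fun i ↦
      ⟨⟨u i, mem_fixedField_zpowers (hu i)⟩,
        ⟨w i / w 0, mem_fixedField_zpowers (by rw [map_div₀, hw, hw, neg_div_neg_eq])⟩, 2, h2K,
        Subtype.ext (by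
          change u i ^ 2 - w 0 ^ 2 * (w i / w 0) ^ 2 = algebraMap k K (a i) * 2 ^ 2
          have := hx i
          rw [div_pow, mul_div_cancel₀ _ (pow_ne_zero 2 (hw0 0))]
          simp only [u, w]
          field_simp
          ring)⟩
  exact hj P hP0 hP 0 D rfl c hc0 hPc

open scoped IntermediateField.algebraAdjoinAdjoin in
theorem AlgebraicIndependent.of_isAlgebraic_adjoin {ι k K : Type*} [Finite ι] [Field k] [Field K]
    [Algebra k K] {y z : ι → K} (hy : AlgebraicIndependent k y)
    [Algebra.IsAlgebraic (IntermediateField.adjoin k (Set.range z)) K] :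
    AlgebraicIndependent k z := by
  have : Algebra.IsAlgebraic (Algebra.adjoin k (Set.range z))
      (IntermediateField.adjoin k (Set.range z)) :=
    IsLocalization.isAlgebraic _ (nonZeroDivisors (Algebra.adjoin k (Set.range z)))
  have : Algebra.IsAlgebraic (Algebra.adjoin k (Set.range z)) K :=
    .trans _ (IntermediateField.adjoin k (Set.range z)) _
  exact (Algebra.IsAlgebraic.isTranscendenceBasis_of_lift_le_trdeg_of_finite k z
    hy.lift_cardinalMk_le_trdeg).1

/-- If `K` is generated over `E` by a square root `t` of an element of `E`, and `σ` fixes `E` and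
negates `t`, then `E` is the fixed field of `σ`. -/
theorem fixedField_zpowers_eq_of_sq_mem {k K : Type*} [Field k] [Field K] [Algebra k K]
    (h2 : (2 : K) ≠ 0) {σ : K ≃ₐ[k] K} {S : Set K} (hS : ∀ x ∈ S, σ x = x) {t : K}
    (ht : σ t = -t) (ht2 : t ^ 2 ∈ IntermediateField.adjoin k S)
    (hT : IntermediateField.adjoin k (insert t S) = ⊤) :
    IntermediateField.fixedField (Subgroup.zpowers σ) = IntermediateField.adjoin k S ∧
      Algebra.IsAlgebraic (IntermediateField.adjoin k S) K := by
  set E := IntermediateField.adjoin k S with hE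
  have hle : E ≤ IntermediateField.fixedField (Subgroup.zpowers σ) :=
    IntermediateField.adjoin_le_iff.mpr fun x hx ↦ mem_fixedField_zpowers (hS x hx)
  have hσE {x : K} (hx : x ∈ E) : σ x = x :=
    (IntermediateField.mem_fixedField_iff _ _).mp (hle hx) σ (Subgroup.mem_zpowers σ)
  have htInt : IsIntegral E t := by
    refine .of_pow two_pos ?_
    exact isIntegral_algebraMap (R := E) (x := ⟨t ^ 2, ht2⟩)
  have htop : IntermediateField.adjoin E {t} = ⊤ := by
    apply IntermediateField.restrictScalars_injective k
    rw [IntermediateField.restrictScalars_top, eq_top_iff, ← hT, IntermediateField.adjoin_le_iff,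
      Set.insert_subset_iff]
    refine ⟨IntermediateField.subset_adjoin E {t} rfl, fun x hx ↦ ?_⟩
    exact (IntermediateField.adjoin E {t}).algebraMap_mem
      (⟨x, IntermediateField.subset_adjoin k S hx⟩ : E)
  have hrep (x : K) : ∃ α β : E, x = α + β * t := by
    have hx : x ∈ Algebra.adjoin E {t} := by
      rw [← IntermediateField.adjoin_simple_toSubalgebra_of_isAlgebraic htInt.isAlgebraic, htop]
      exact Algebra.mem_top
    induction hx using Algebra.adjoin_induction with
    | mem y hy => exact ⟨0, 1, by simp [Set.mem_singleton_iff.mp hy]⟩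
    | algebraMap r => exact ⟨r, 0, by simp⟩
    | add y z _ _ hy hz =>
      obtain ⟨α, β, rfl⟩ := hy
      obtain ⟨γ, δ, rfl⟩ := hz
      exact ⟨α + γ, β + δ, by push_cast; ring⟩
    | mul y z _ _ hy hz =>
      obtain ⟨α, β, rfl⟩ := hy
      obtain ⟨γ, δ, rfl⟩ := hz
      exact ⟨α * γ + β * δ * ⟨t ^ 2, ht2⟩, α * δ + β * γ, by push_cast; ring⟩
  refine ⟨le_antisymm (fun x hx ↦ ?_) hle, ⟨fun x ↦ ?_⟩⟩
  · obtain ⟨α, β, rfl⟩ := hrep x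
    have h := (IntermediateField.mem_fixedField_iff _ _).mp hx σ (Subgroup.mem_zpowers σ)
    rw [map_add, map_mul, ht, hσE α.2, hσE β.2] at h
    have : 2 * (β * t) = 0 := by linear_combination -h
    rw [(mul_eq_zero.mp this).resolve_left h2, add_zero]
    exact α.2
  · obtain ⟨α, β, rfl⟩ := hrep x
    exact (isAlgebraic_algebraMap α).add ((isAlgebraic_algebraMap β).mul htInt.isAlgebraic)

theorem isRational_fixedField_of_sq {k K : Type*} [Field k] [Field K] [Algebra k K]
    (h2 : (2 : k) ≠ 0) {x : Fin 3 → K} (hx : AlgebraicIndependent k x) {u y z : K}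
    (htop : IntermediateField.adjoin k {u, y, z} = ⊤) {σ : K ≃ₐ[k] K} {b c d : k}
    (hb : b ≠ 0) (hc : c ≠ 0) (hd : d ≠ 0) (hu : σ u = algebraMap k K b ^ 2 * u⁻¹)
    (hy : σ y = algebraMap k K c * y⁻¹) (hz : σ z = algebraMap k K d * z⁻¹) :
    IsRational k (IntermediateField.fixedField (Subgroup.zpowers σ)) := by
  let q : Fin 3 → K := ![u, y, z]
  have hai : AlgebraicIndependent k q := by
    refine hx.of_adjoin_eq_top ?_
    rw [← htop]
    congr 1
    ext
    simp [Matrix.range_cons, or_comm, or_left_comm, q]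
  have hne (p : MvPolynomial (Fin 3) k) (v : Fin 3 → k) (hp : MvPolynomial.eval v p ≠ 0) {x : K}
      (hx : MvPolynomial.aeval q p = x) : x ≠ 0 := by
    rintro rfl
    exact hp (by rw [hai.eq_zero_of_aeval_eq_zero p hx, map_zero])
  have hK2 : (2 : K) ≠ 0 := by
    have h := (_root_.map_ne_zero (algebraMap k K)).mpr h2
    rwa [map_ofNat] at h
  have hu0 : u ≠ 0 := hne (MvPolynomial.X 0) 1 (by simp) (by simp [q])
  have hy0 : y ≠ 0 := hne (MvPolynomial.X 1) 1 (by simp) (by simp [q])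
  have hz0 : z ≠ 0 := hne (MvPolynomial.X 2) 1 (by simp) (by simp [q])
  have hub : u + algebraMap k K b ≠ 0 :=
    hne (MvPolynomial.X 0 + MvPolynomial.C b) 0 (by simp [hb]) (by
      simp only [map_add, MvPolynomial.aeval_X, MvPolynomial.aeval_C]
      rfl)
  have hub' : u - algebraMap k K b ≠ 0 :=
    hne (MvPolynomial.X 0 - MvPolynomial.C b) 0 (by simp [hb]) (by
      simp only [map_sub, MvPolynomial.aeval_X, MvPolynomial.aeval_C]
      rfl)
  have hyc : y ^ 2 - algebraMap k K c ≠ 0 :=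
    hne (MvPolynomial.X 1 ^ 2 - MvPolynomial.C c) 0 (by simp [hc]) (by
      simp only [map_sub, map_pow, MvPolynomial.aeval_X, MvPolynomial.aeval_C]
      rfl)
  have hzd : z ^ 2 - algebraMap k K d ≠ 0 :=
    hne (MvPolynomial.X 2 ^ 2 - MvPolynomial.C d) 0 (by simp [hd]) (by
      simp only [map_sub, map_pow, MvPolynomial.aeval_X, MvPolynomial.aeval_C]
      rfl)
  have hyz : algebraMap k K d * y ^ 2 - algebraMap k K c * z ^ 2 ≠ 0 :=
    hne (MvPolynomial.C d * MvPolynomial.X 1 ^ 2 -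
      MvPolynomial.C c * MvPolynomial.X 2 ^ 2) ![0, 1, 0] (by simp [hd]) (by
      simp only [map_sub, map_mul, map_pow, MvPolynomial.aeval_X, MvPolynomial.aeval_C]
      rfl)
  have hσk (e : k) : σ (algebraMap k K e) = algebraMap k K e := σ.commutes e
  replace hb : algebraMap k K b ≠ 0 := by simpa using hb
  replace hc : algebraMap k K c ≠ 0 := by simpa using hc
  replace hd : algebraMap k K d ≠ 0 := by simpa using hd
  obtain ⟨t, ht⟩ : ∃ t, t = (u - algebraMap k K b) / (u + algebraMap k K b) := ⟨_, rfl⟩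
  obtain ⟨r, hr⟩ : ∃ r, r = y + algebraMap k K c * y⁻¹ := ⟨_, rfl⟩
  obtain ⟨w, hw⟩ : ∃ w, w = y - algebraMap k K c * y⁻¹ := ⟨_, rfl⟩
  obtain ⟨r', hr'⟩ : ∃ r', r' = z + algebraMap k K d * z⁻¹ := ⟨_, rfl⟩
  obtain ⟨w', hw'⟩ : ∃ w', w' = z - algebraMap k K d * z⁻¹ := ⟨_, rfl⟩
  have ht0 : t ≠ 0 := ht ▸ div_ne_zero hub' hub
  have hw0 : w ≠ 0 := by
    rw [show w = (y ^ 2 - algebraMap k K c) / y by rw [hw]; field_simp]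
    exact div_ne_zero hyc hy0
  have hw'0 : w' ≠ 0 := by
    rw [show w' = (z ^ 2 - algebraMap k K d) / z by rw [hw']; field_simp]
    exact div_ne_zero hzd hz0
  have hσt : σ t = -t := by
    have : algebraMap k K b + u ≠ 0 := by rwa [add_comm]
    rw [ht, map_div₀, map_sub, map_add, hu, hσk,
      show algebraMap k K b ^ 2 * u⁻¹ - algebraMap k K b =
        (algebraMap k K b * u⁻¹) * -(u - algebraMap k K b) by field_simp; ring,
      show algebraMap k K b ^ 2 * u⁻¹ + algebraMap k K b =
        (algebraMap k K b * u⁻¹) * (u + algebraMap k K b) by field_simp; ring,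
      mul_div_mul_left _ _ (mul_ne_zero hb (inv_ne_zero hu0)), neg_div]
  have hσr : σ r = r := by
    rw [hr, map_add, map_mul, map_inv₀, hσk, hy]
    field_simp
    ring
  have hσw : σ w = -w := by
    rw [hw, map_sub, map_mul, map_inv₀, hσk, hy]
    field_simp
    ring
  have hσr' : σ r' = r' := by
    rw [hr', map_add, map_mul, map_inv₀, hσk, hz]
    field_simp
    ring
  have hσw' : σ w' = -w' := by
    rw [hw', map_sub, map_mul, map_inv₀, hσk, hz]
    field_simp
    ring
  have hrw : r ^ 2 = w ^ 2 + 4 * algebraMap k K c := by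
    rw [hr, hw]
    field_simp
    ring
  have hrw' : r' ^ 2 = w' ^ 2 + 4 * algebraMap k K d := by
    rw [hr', hw']
    field_simp
    ring
  obtain ⟨v, hv⟩ : ∃ v, v = w / t := ⟨_, rfl⟩
  obtain ⟨s, hs⟩ : ∃ s, s = w' / w := ⟨_, rfl⟩
  obtain ⟨p, hp⟩ : ∃ p, p = r' - r * s := ⟨_, rfl⟩
  have hv0 : v ≠ 0 := hv ▸ div_ne_zero hw0 ht0
  have hs0 : s ≠ 0 := hs ▸ div_ne_zero hw'0 hw0
  have hp0 : p ≠ 0 := by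
    have : p * (w * (y * z)) = 2 * (algebraMap k K d * y ^ 2 - algebraMap k K c * z ^ 2) := by
      have : p * w = r' * w - r * w' := by
        rw [hp, hs]
        field_simp
      rw [← mul_assoc, this, hr, hw, hr', hw']
      field_simp
      ring
    intro h
    rw [h, zero_mul] at this
    exact mul_ne_zero hK2 hyz this.symm
  let e : Fin 3 → K := ![v, s, p]
  have hve : v ∈ IntermediateField.adjoin k (Set.range e) :=
    IntermediateField.subset_adjoin k _ ⟨0, rfl⟩
  have hse : s ∈ IntermediateField.adjoin k (Set.range e) :=
    IntermediateField.subset_adjoin k _ ⟨1, rfl⟩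
  have hpe : p ∈ IntermediateField.adjoin k (Set.range e) :=
    IntermediateField.subset_adjoin k _ ⟨2, rfl⟩
  have hke (E : IntermediateField k K) (c : k) : algebraMap k K c ∈ E := E.algebraMap_mem c
  have hre' : r' ∈ IntermediateField.adjoin k (Set.range e) := by
    have : r' = (p + 4 * (algebraMap k K d - algebraMap k K c * s ^ 2) / p) / 2 := by
      have hw's : w' = s * w := by rw [hs]; field_simp
      have : (r' + r * s) * p = 4 * (algebraMap k K d - algebraMap k K c * s ^ 2) := by
        rw [hp]
        rw [hw's] at hrw'
        linear_combination hrw' - s ^ 2 * hrw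
      rw [← this, mul_div_cancel_right₀ _ hp0, hp]
      field_simp
      ring
    rw [this]
    exact div_mem (add_mem hpe (div_mem (mul_mem (ofNat_mem _ 4)
      (sub_mem (hke _ d) (mul_mem (hke _ c) (pow_mem hse 2)))) hpe)) (ofNat_mem _ 2)
  have hre : r ∈ IntermediateField.adjoin k (Set.range e) := by
    rw [show r = (r' - p) / s by rw [hp]; field_simp; ring]
    exact div_mem (sub_mem hre' hpe) hse
  have hte : t ^ 2 ∈ IntermediateField.adjoin k (Set.range e) := by
    have : t ^ 2 = (r ^ 2 - 4 * algebraMap k K c) / v ^ 2 := by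
      rw [hrw, hv]
      field_simp
      ring
    rw [this]
    exact div_mem (sub_mem (pow_mem hre 2) (mul_mem (ofNat_mem _ 4) (hke _ c))) (pow_mem hve 2)
  have hT : IntermediateField.adjoin k (insert t (Set.range e)) = ⊤ := by
    have hle := IntermediateField.adjoin.mono k _ _ (Set.subset_insert t (Set.range e))
    have htT : t ∈ IntermediateField.adjoin k (insert t (Set.range e)) :=
      IntermediateField.subset_adjoin k _ (Set.mem_insert _ _)
    have hwT : w ∈ IntermediateField.adjoin k (insert t (Set.range e)) := by
      rw [show w = v * t by rw [hv]; field_simp]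
      exact mul_mem (hle hve) htT
    have hwT' : w' ∈ IntermediateField.adjoin k (insert t (Set.range e)) := by
      rw [show w' = s * w by rw [hs]; field_simp]
      exact mul_mem (hle hse) hwT
    rw [eq_top_iff, ← htop, IntermediateField.adjoin_le_iff, Set.insert_subset_iff,
      Set.insert_subset_iff, Set.singleton_subset_iff]
    refine ⟨?_, ?_, ?_⟩
    · have h1 : (1 - t) * (u + algebraMap k K b) = 2 * algebraMap k K b := by
        rw [ht]
        field_simp
        ring
      have h2 : 1 - t ≠ 0 := left_ne_zero_of_mul (h1 ▸ mul_ne_zero hK2 hb)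
      have : u = 2 * algebraMap k K b / (1 - t) - algebraMap k K b := by
        rw [← h1, mul_div_cancel_left₀ _ h2, add_sub_cancel_right]
      change u ∈ IntermediateField.adjoin k _
      rw [this]
      exact sub_mem (div_mem (mul_mem (ofNat_mem _ 2) (hke _ b)) (sub_mem (one_mem _) htT))
        (hke _ b)
    · change y ∈ IntermediateField.adjoin k _
      rw [show y = (r + w) / 2 by rw [hr, hw]; field_simp; ring]
      exact div_mem (add_mem (hle hre) hwT) (ofNat_mem _ 2)
    · change z ∈ IntermediateField.adjoin k _
      rw [show z = (r' + w') / 2 by rw [hr', hw']; field_simp; ring]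
      exact div_mem (add_mem (hle hre') hwT') (ofNat_mem _ 2)
  have hσs : σ s = s := by rw [hs, map_div₀, hσw, hσw', neg_div_neg_eq]
  have hσe : ∀ x ∈ Set.range e, σ x = x := by
    rintro _ ⟨i, rfl⟩
    fin_cases i
    · change σ v = v
      rw [hv, map_div₀, hσw, hσt, neg_div_neg_eq]
    · exact hσs
    · change σ p = p
      rw [hp, map_sub, map_mul, hσr, hσr', hσs]
  obtain ⟨hfix, halg⟩ := fixedField_zpowers_eq_of_sq_mem hK2 hσe hσt hte hT
  have he : AlgebraicIndependent k e := hx.of_isAlgebraic_adjoin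
  rw [hfix]
  exact ⟨3, ⟨he.aevalEquivField.symm⟩⟩

theorem IsRational.isRetractRational {k K : Type*} [Field k] [Field K] [Algebra k K]
    (h : IsRational k K) : IsRetractRational k K := by
  obtain ⟨n, ⟨e⟩⟩ := h
  let R := MvPolynomial (Fin n) k
  let i : R →ₐ[k] K := e.symm.toAlgHom.comp (IsScalarTower.toAlgHom k R (FractionRing R))
  have hi : Function.Injective i := e.symm.injective.comp (IsFractionRing.injective R _)
  let ε : R ≃ₐ[k] i.range := AlgEquiv.ofInjective i hi
  have hfrac : IsFractionRing i.range K := .of_field _ _ fun x ↦ by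
    obtain ⟨p, q, hq, h⟩ := IsFractionRing.div_surjective R (e x)
    refine ⟨ε p, ε q, ?_⟩
    rw [← e.symm_apply_apply x, ← h, map_div₀]
    rfl
  let δ : R ≃ₐ[k] Localization.Away (1 : R) :=
    (IsLocalization.atOne R (Localization.Away (1 : R))).restrictScalars k
  refine ⟨i.range, hfrac, n, 1, one_ne_zero, δ.toAlgHom.comp ε.symm.toAlgHom,
    ε.toAlgHom.comp δ.symm.toAlgHom, AlgHom.ext fun x ↦ ?_⟩
  simp

theorem isRational_fixedField_of_prod_eq_sq {k : Type*} [Field k] (h2 : (2 : k) ≠ 0)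
    {a : Fin 3 → k} (ha : ∀ i, a i ≠ 0)
    {σ : FractionRing (MvPolynomial (Fin 3) k) ≃ₐ[k] FractionRing (MvPolynomial (Fin 3) k)}
    (hσ : ∀ i : Fin 3, σ (algebraMap (MvPolynomial (Fin 3) k) _ (MvPolynomial.X i)) =
      algebraMap k _ (a i) * (algebraMap (MvPolynomial (Fin 3) k) _ (MvPolynomial.X i))⁻¹)
    {I : Finset (Fin 3)} (hI : I.Nonempty) {b : k} (hb : ∏ i ∈ I, a i = b ^ 2) :
    IsRational k (IntermediateField.fixedField (Subgroup.zpowers σ)) := by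
  obtain ⟨i₀, hi₀⟩ := hI
  have hcover : ∀ i₀ : Fin 3, ∃ i₁ i₂ : Fin 3, ∀ i, i ≠ i₀ → i = i₁ ∨ i = i₂ := by decide
  obtain ⟨i₁, i₂, hi⟩ := hcover i₀
  let x (i : Fin 3) : FractionRing (MvPolynomial (Fin 3) k) :=
    algebraMap (MvPolynomial (Fin 3) k) _ (MvPolynomial.X i)
  have hx0 (i) : x i ≠ 0 := by simp [x]
  have hx : AlgebraicIndependent k x :=
    (MvPolynomial.algebraicIndependent_X (Fin 3) k).map'
      (f := IsScalarTower.toAlgHom k _ (FractionRing (MvPolynomial (Fin 3) k)))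
      (IsFractionRing.injective _ _)
  have hxtop : IntermediateField.adjoin k (Set.range x) = ⊤ := by
    rw [eq_top_iff]
    intro z _
    obtain ⟨p, q, hq, rfl⟩ := IsFractionRing.div_surjective (MvPolynomial (Fin 3) k) z
    have hmem (p : MvPolynomial (Fin 3) k) :
        algebraMap _ (FractionRing (MvPolynomial (Fin 3) k)) p ∈
          IntermediateField.adjoin k (Set.range x) := by
      induction p using MvPolynomial.induction_on with
      | C c => exact (IntermediateField.adjoin k (Set.range x)).algebraMap_mem c
      | add p q hp hq => rw [map_add]; exact add_mem hp hq
      | mul_X p i hp =>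
        rw [map_mul]
        exact mul_mem hp (IntermediateField.subset_adjoin k _ ⟨i, rfl⟩)
    exact div_mem (hmem p) (hmem q)
  have hb0 : b ≠ 0 := by
    rintro rfl
    exact Finset.prod_ne_zero_iff.mpr (fun i _ ↦ ha i) (hb.trans (zero_pow two_ne_zero))
  refine isRational_fixedField_of_sq (u := ∏ i ∈ I, x i) (y := x i₁) (z := x i₂) h2 hx ?_ hb0
    (ha i₁) (ha i₂) ?_ (hσ i₁) (hσ i₂)
  · have hmem {i : Fin 3} (h : i ≠ i₀) :
        x i ∈ IntermediateField.adjoin k {∏ i ∈ I, x i, x i₁, x i₂} := by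
      apply IntermediateField.subset_adjoin
      rcases hi i h with rfl | rfl <;> simp
    rw [eq_top_iff, ← hxtop, IntermediateField.adjoin_le_iff]
    rintro _ ⟨i, rfl⟩
    change x i ∈ IntermediateField.adjoin k {∏ i ∈ I, x i, x i₁, x i₂}
    obtain rfl | h := eq_or_ne i i₀
    · rw [← mul_div_cancel_right₀ (x i)
        (Finset.prod_ne_zero_iff.mpr fun j (_ : j ∈ I.erase i) ↦ hx0 j),
        Finset.mul_prod_erase I x hi₀]
      exact div_mem (IntermediateField.subset_adjoin k _ (by simp))
        (prod_mem fun j hj ↦ hmem (Finset.ne_of_mem_erase hj))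
    · exact hmem h
  · rw [map_prod, Finset.prod_congr rfl fun i _ ↦ hσ i, Finset.prod_mul_distrib, ← map_prod, hb,
      map_pow, Finset.prod_inv_distrib]

/-- **Saltman, Kang.** Let `k` be a field with `char k ≠ 2`, let `a₁, a₂, a₃ ∈ kˣ` and let `σ`
be the `k`-automorphism of `k(x₁,x₂,x₃)` with `σ(xᵢ) = aᵢ/xᵢ`. Then `k(x₁,x₂,x₃)^⟨σ⟩` is not
`k`-rational iff `[k(√a₁,√a₂,√a₃) : k] = 8` (the splitting field of
`(X²-a₁)(X²-a₂)(X²-a₃)` has degree `8` over `k`); moreover, if it is not `k`-rational then it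
is not retract `k`-rational. -/
theorem saltman_kang_involution
    (k : Type*) [Field k] (hchar : ringChar k ≠ 2) (a : Fin 3 → k) (ha : ∀ i, a i ≠ 0)
    (σ : FractionRing (MvPolynomial (Fin 3) k) ≃ₐ[k] FractionRing (MvPolynomial (Fin 3) k))
    (hσ : ∀ i : Fin 3, σ (algebraMap (MvPolynomial (Fin 3) k) _ (X i)) =
      algebraMap k _ (a i) * (algebraMap (MvPolynomial (Fin 3) k) _ (X i))⁻¹) :
    (¬ IsRational k (IntermediateField.fixedField (Subgroup.zpowers σ)) ↔
      Module.finrank k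
        (((Polynomial.X ^ 2 - Polynomial.C (a 0)) * (Polynomial.X ^ 2 - Polynomial.C (a 1)) *
          (Polynomial.X ^ 2 - Polynomial.C (a 2))).SplittingField) = 8) ∧
    (¬ IsRational k (IntermediateField.fixedField (Subgroup.zpowers σ)) →
      ¬ IsRetractRational k (IntermediateField.fixedField (Subgroup.zpowers σ))) := by
  have h2 : (2 : k) ≠ 0 := Ring.two_ne_zero hchar
  generalize hp : (Polynomial.X ^ 2 - Polynomial.C (a 0)) *
    (Polynomial.X ^ 2 - Polynomial.C (a 1)) * (Polynomial.X ^ 2 - Polynomial.C (a 2)) = p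
  obtain ⟨hgal, s, hs, htop⟩ := exists_sqrt_splittingField (p := p) h2 ha
    (by rw [Fin.prod_univ_three, hp])
  have hl2 : (2 : p.SplittingField) ≠ 0 := by
    have h := (_root_.map_ne_zero (algebraMap k p.SplittingField)).mpr h2
    rwa [map_ofNat] at h
  have hs0 (i) : s i ≠ 0 := by
    intro h
    have := hs i
    rw [h, zero_pow two_ne_zero, eq_comm, _root_.map_eq_zero] at this
    exact ha i this
  have hrat (h : ¬ IsRational k (IntermediateField.fixedField (Subgroup.zpowers σ))) :
      Module.finrank k p.SplittingField = 8 := by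
    by_contra h8
    obtain ⟨I, hI, b, hb⟩ := exists_prod_eq_sq_of_finrank_ne hl2 hs0 hs htop h8
    exact h (isRational_fixedField_of_prod_eq_sq h2 ha hσ hI hb)
  have hret (h : Module.finrank k p.SplittingField = 8) :
      ¬ IsRetractRational k (IntermediateField.fixedField (Subgroup.zpowers σ)) := by
    obtain ⟨ρ, hρk, hρs⟩ := exists_ringAut_of_finrank_eq hl2 hs0 hs htop h
    exact not_isRetractRational_fixedField h2 hρk ha hs hρs hσ
  exact ⟨⟨hrat, fun h h' ↦ hret h h'.isRetractRational⟩, fun h ↦ hret (hrat h)⟩
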